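/- There are no triples (x, y, z) of odd, pairwise coprime integers satisfying 3^{31}·x^{34} − 4y^{17} = 7z^2. -/

import Mathlib

/-- Jacobi symbol with an integer denominator (absolute value). -/
def KJ (a b : ℤ) : ℤ := jacobiSym a b.natAbs

lemma KJ_mul (a c b : ℤ) : KJ (a * c) b = KJ a b * KJ c b := jacobiSym.mul_left a c _

lemma KJ_pow (a b : ℤ) (n : ℕ) : KJ (a ^ n) b = KJ a b ^ n := jacobiSym.pow_left a n _

lemma KJ_neg_right (a b : ℤ) : KJ a (-b) = KJ a b := by simp [KJ]

lemma KJ_mod {a c b q : ℤ} (h : a = q * b + c) : KJ a b = KJ c b := by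
  unfold KJ
  apply jacobiSym.mod_left'
  have h2 : ((b.natAbs : ℤ)) ∣ a - c := by
    rw [Int.natAbs_dvd]; exact ⟨q, by rw [h]; ring⟩
  exact Int.emod_eq_emod_iff_emod_sub_eq_zero.2 (Int.emod_eq_zero_of_dvd h2)

lemma KJ_sq {a b : ℤ} (h : IsCoprime a b) : KJ a b ^ 2 = 1 := by
  unfold KJ
  have : a.gcd (b.natAbs) = 1 := by
    have h1 := Int.isCoprime_iff_gcd_eq_one.1 h
    rw [Int.gcd] at h1 ⊢
    rwa [Int.natAbs_natCast]
  exact jacobiSym.sq_one this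

lemma KJ_neg_one {b : ℤ} (hb : 0 < b) (h2 : b % 2 = 1) :
    KJ (-1) b = if b % 4 = 1 then 1 else -1 := by
  obtain ⟨n, rfl⟩ := Int.eq_ofNat_of_zero_le hb.le
  unfold KJ
  rw [jacobiSym.at_neg_one (by simp; rw [Nat.odd_iff]; omega)]
  simp only [Int.natAbs_natCast]
  rw [ZMod.χ₄_nat_eq_if_mod_four]
  split_ifs <;> first | rfl | omega

lemma KJ_two {b : ℤ} (h2 : b % 2 = 1) :
    KJ 2 b = if b % 8 = 1 ∨ b % 8 = 7 then 1 else -1 := by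
  unfold KJ
  rw [jacobiSym.at_two (by rw [Nat.odd_iff]; omega), ZMod.χ₈_nat_eq_if_mod_eight]
  split_ifs <;> first | rfl | omega

lemma recip_pos {a b : ℤ} (ha : 0 < a) (hb : 0 < b) (ha2 : a % 2 = 1) (hb2 : b % 2 = 1)
    (h : IsCoprime a b) : KJ a b = (if a % 4 = 3 ∧ b % 4 = 3 then -1 else 1) * KJ b a := by
  obtain ⟨n, rfl⟩ := Int.eq_ofNat_of_zero_le ha.le
  obtain ⟨m, rfl⟩ := Int.eq_ofNat_of_zero_le hb.le
  unfold KJ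
  simp only [Int.natAbs_natCast]
  split_ifs with h3
  · rw [jacobiSym.quadratic_reciprocity_three_mod_four (by omega) (by omega)]; ring
  · by_cases h4 : n % 4 = 1
    · rw [jacobiSym.quadratic_reciprocity_one_mod_four h4 (by rw [Nat.odd_iff]; omega)]; ring
    · rw [← jacobiSym.quadratic_reciprocity_one_mod_four (a := m) (b := n) (by omega) (by rw [Nat.odd_iff]; omega)]; ring

lemma KJ_recip {a b : ℤ} (hs : 0 < a ∨ 0 < b) (ha2 : a % 2 = 1) (hb2 : b % 2 = 1)
    (h : IsCoprime a b) : KJ a b = (if a % 4 = 3 ∧ b % 4 = 3 then -1 else 1) * KJ b a := by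
  have key : ∀ a b : ℤ, a < 0 → 0 < b → a % 2 = 1 → b % 2 = 1 → IsCoprime a b →
      KJ a b = (if a % 4 = 3 ∧ b % 4 = 3 then -1 else 1) * KJ b a := by
    intro a b ha hb ha2 hb2 h
    have h1 := recip_pos (a := -a) (b := b) (by omega) hb (by omega) hb2 h.neg_left
    have h2 : KJ a b = KJ (-1) b * KJ (-a) b := by rw [← KJ_mul]; ring_nf
    rw [h2, h1, KJ_neg_right, KJ_neg_one hb hb2, ← mul_assoc]
    congr 1
    split_ifs <;> first | rfl | omega
  rcases lt_or_ge 0 a with ha | ha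
  · rcases lt_or_ge 0 b with hb | hb
    · exact recip_pos ha hb ha2 hb2 h
    · have := key b a (by omega) ha hb2 ha2 h.symm
      rw [this, ← mul_assoc]
      have : ((if a % 4 = 3 ∧ b % 4 = 3 then -1 else 1) * if b % 4 = 3 ∧ a % 4 = 3 then -1 else 1 : ℤ) = 1 := by
        split_ifs <;> first | rfl | omega
      rw [this, one_mul]
  · exact key a b (by omega) (by omega) ha2 hb2 h

lemma KJ_at_three (b : ℤ) : KJ b 3 = if b % 3 = 0 then 0 else if b % 3 = 1 then 1 else -1 := by
  have h : KJ b 3 = KJ (b % 3) 3 := KJ_mod (q := b / 3) (by omega)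
  rw [h]
  have : b % 3 = 0 ∨ b % 3 = 1 ∨ b % 3 = 2 := by omega
  rcases this with h | h | h <;> rw [h] <;> unfold KJ <;> norm_num

lemma KJ_at_five (b : ℤ) : KJ b 5 = if b % 5 = 0 then 0 else if b % 5 = 1 ∨ b % 5 = 4 then 1 else -1 := by
  have h : KJ b 5 = KJ (b % 5) 5 := KJ_mod (q := b / 5) (by omega)
  rw [h]
  have : b % 5 = 0 ∨ b % 5 = 1 ∨ b % 5 = 2 ∨ b % 5 = 3 ∨ b % 5 = 4 := by omega
  rcases this with h | h | h | h | h <;> rw [h] <;> unfold KJ <;> norm_num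

lemma KJ_at_seven (b : ℤ) : KJ b 7 = if b % 7 = 0 then 0 else
    if b % 7 = 1 ∨ b % 7 = 2 ∨ b % 7 = 4 then 1 else -1 := by
  have h : KJ b 7 = KJ (b % 7) 7 := KJ_mod (q := b / 7) (by omega)
  rw [h]
  have : b % 7 = 0 ∨ b % 7 = 1 ∨ b % 7 = 2 ∨ b % 7 = 3 ∨ b % 7 = 4 ∨ b % 7 = 5 ∨ b % 7 = 6 := by omega
  rcases this with h | h | h | h | h | h | h <;> rw [h] <;> unfold KJ <;> norm_num

lemma cop_of_prime {q b : ℤ} (hq : Prime q) (h : ¬ q ∣ b) : IsCoprime q b :=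
  (Prime.coprime_iff_not_dvd hq).2 h

lemma cop2 {b : ℤ} (h : b % 2 = 1) : IsCoprime 2 b := cop_of_prime Int.prime_two (by omega)
lemma cop3 {b : ℤ} (h : b % 3 ≠ 0) : IsCoprime 3 b := cop_of_prime Int.prime_three (by omega)
lemma cop5 {b : ℤ} (h : b % 5 ≠ 0) : IsCoprime 5 b :=
  cop_of_prime (by norm_num [Int.prime_iff_natAbs_prime]) (by omega)
lemma cop7 {b : ℤ} (h : b % 7 ≠ 0) : IsCoprime 7 b :=
  cop_of_prime (by norm_num [Int.prime_iff_natAbs_prime]) (by omega)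

lemma KJ_three {b : ℤ} (h2 : b % 2 = 1) (h3 : b % 3 ≠ 0) :
    KJ 3 b = if b % 12 = 1 ∨ b % 12 = 11 then 1 else -1 := by
  rw [KJ_recip (by norm_num) (by norm_num) h2 (cop3 h3), KJ_at_three]
  split_ifs <;> first | rfl | omega

lemma KJ_five {b : ℤ} (h2 : b % 2 = 1) (h5 : b % 5 ≠ 0) :
    KJ 5 b = if b % 5 = 1 ∨ b % 5 = 4 then 1 else -1 := by
  rw [KJ_recip (by norm_num) (by norm_num) h2 (cop5 h5), KJ_at_five]
  split_ifs <;> first | rfl | omega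

lemma KJ_square {a b : ℤ} (h : IsCoprime a b) : KJ (a ^ 2) b = 1 := by rw [KJ_pow, KJ_sq h]

/-- cancel an unknown square -/
lemma KJ_mul_sq {c z b d : ℤ} (h : KJ (c * z ^ 2) b = d) (hd : d ≠ 0) : KJ c b = d := by
  rw [KJ_mul, KJ_pow] at h
  have hz : KJ z b ≠ 0 := by
    intro h0; rw [h0] at h; apply hd; rw [← h]; ring
  have : KJ z b = 1 ∨ KJ z b = -1 := by
    rcases jacobiSym.trichotomy z b.natAbs with h | h | h
    · exact absurd h hz
    · exact Or.inl h
    · exact Or.inr h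
  rcases this with h1 | h1 <;> rw [h1] at h <;> linarith

def k2 (r : ℤ) : ℤ := if r % 8 = 1 ∨ r % 8 = 7 then 1 else -1
def k3 (r : ℤ) : ℤ := if r % 12 = 1 ∨ r % 12 = 11 then 1 else -1
def km (r : ℤ) : ℤ := if r % 4 = 1 then 1 else -1
def ee (a b : ℤ) : ℤ := if a % 4 = 3 ∧ b % 4 = 3 then -1 else 1

/-- `b` is congruent to `r` mod 24, and `r` is coprime to 6. -/
def Res (b r : ℤ) : Prop := b % 24 = r ∧ r % 2 = 1 ∧ r % 3 ≠ 0

lemma Res.k2 {b r : ℤ} (h : Res b r) : KJ 2 b = k2 r := by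
  obtain ⟨h1, h2, h3⟩ := h
  rw [KJ_two (by omega), _root_.k2]
  split_ifs <;> first | rfl | omega

lemma Res.k3 {b r : ℤ} (h : Res b r) : KJ 3 b = k3 r := by
  obtain ⟨h1, h2, h3⟩ := h
  rw [KJ_three (by omega) (by omega), _root_.k3]
  split_ifs <;> first | rfl | omega

lemma Res.km {b r : ℤ} (h : Res b r) (hb : 0 < b) : KJ (-1) b = km r := by
  obtain ⟨h1, h2, h3⟩ := h
  rw [KJ_neg_one hb (by omega), _root_.km]
  split_ifs <;> first | rfl | omega

lemma Res.ee {a b r s : ℤ} (h : Res a r) (h' : Res b s) (hs : 0 < a ∨ 0 < b)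
    (hc : IsCoprime a b) : KJ a b = ee r s * KJ b a := by
  obtain ⟨h1, h2, h3⟩ := h
  obtain ⟨h1', h2', h3'⟩ := h'
  rw [KJ_recip hs (by omega) (by omega) hc, _root_.ee]
  congr 1
  split_ifs <;> first | rfl | omega

lemma Res.neg {a r : ℤ} (h : Res a r) : Res (-a) (24 - r) := by
  obtain ⟨h1, h2, h3⟩ := h
  refine ⟨?_, ?_, ?_⟩ <;> omega

lemma Res.cop2 {b r : ℤ} (h : Res b r) : IsCoprime 2 b :=
  _root_.cop2 (by obtain ⟨h1, h2, h3⟩ := h; omega)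
lemma Res.cop3 {b r : ℤ} (h : Res b r) : IsCoprime 3 b :=
  _root_.cop3 (by obtain ⟨h1, h2, h3⟩ := h; omega)

/-- One step of the Euclid-like algorithm: from a relation `M A = q B + N C` we transfer the
symbol of `A` over `B` to the symbol of `C` over `B`. -/
lemma step {A B C M N q : ℤ} (h : M * A = q * B + N * C) (cN : IsCoprime N B) :
    KJ C B = KJ N B * KJ M B * KJ A B := by
  have h1 : KJ M B * KJ A B = KJ N B * KJ C B := by
    rw [← KJ_mul, ← KJ_mul]; exact KJ_mod h
  have h2 := KJ_sq cN
  linear_combination (-KJ C B) * h2 - KJ N B * h1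

/-- The same relation also transports coprimality, so the whole chain is pairwise coprime as soon
as its last entry is harmless. -/
lemma cop_step {A B C M N q : ℤ} (h : M * A = q * B + N * C) (cN : IsCoprime N B)
    (cC : IsCoprime C B) : IsCoprime A B := by
  obtain ⟨a, b, hab⟩ := cN.mul_left cC
  exact ⟨a * M, b - a * q, by linear_combination hab + a * h⟩

lemma cop_of_eq {p s q c : ℤ} (h : s = q * p + c) (hc : IsCoprime p c) : IsCoprime p s := by
  obtain ⟨a, b, hab⟩ := hc
  exact ⟨a - b * q, b, by rw [h]; linear_combination hab⟩

lemma KJ_p {x p s : ℤ} (hp : p = x ^ 2) (h : IsCoprime p s) : KJ p s = 1 := by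
  rw [hp] at h ⊢
  exact KJ_square ((IsCoprime.pow_left_iff (by norm_num)).1 h)

/-- The first long chain of reciprocity steps. It starts from `7 z ^ 2`, runs through nine binary
forms in `p` and `Q`, ends at the linear form `18 p - Q`, and evaluates the symbol of five over it
in terms of residues modulo twenty-four only. -/
lemma chainB {x p Q z : ℤ} {s0 s1 s2 s3 s4 s5 s6 s7 s8 q0 q1 q2 q3 q4 q5 q6 q7 q8 : ℤ}
    {r0 r1 r2 r3 r4 r5 r6 r7 r8 rQ : ℤ} (hp : p = x ^ 2)
    (i0 : 7 * z ^ 2 = q0 * s0 + (3 ^ 6 * p ^ 3 * Q ^ 5) * s1)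
    (i1 : 1 * s0 = q1 * s1 + (-1 * 3 * p * Q) * s2)
    (i2 : 1 * s1 = q2 * s2 + (3 * p * (-Q)) * s3)
    (i3 : (2 ^ 2 * Q) * s2 = q3 * s3 + (-1 * 3 ^ 6 * p ^ 3) * s4)
    (i4 : (3 ^ 3 * p ^ 2) * s3 = q4 * s4 + (-1 * 2 ^ 2 * Q ^ 5) * s5)
    (i5 : 2 * s4 = q5 * s5 + (3 ^ 5 * p ^ 3) * s6)
    (i6 : (2 * 3) * s5 = q6 * s6 + Q ^ 2 * s7)
    (i7 : 2 * s6 = q7 * s7 + (3 ^ 4 * p ^ 2) * s8)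
    (i8 : 1 * s7 = q8 * s8 + Q ^ 2 * 5)
    (h0 : Res s0 r0) (h1 : Res s1 r1) (h2 : Res s2 r2) (h3 : Res s3 r3) (h4 : Res s4 r4)
    (h5 : Res s5 r5) (h6 : Res s6 r6) (h7 : Res s7 r7) (h8 : Res s8 r8) (hQ : Res Q rQ)
    (cp0 : IsCoprime p s0) (cp1 : IsCoprime p s1) (cp2 : IsCoprime p s2) (cp3 : IsCoprime p s3)
    (cp4 : IsCoprime p s4) (cp5 : IsCoprime p s5) (cp7 : IsCoprime p s7)
    (cQ0 : IsCoprime Q s0) (cQ1 : IsCoprime Q s1) (cQ2 : IsCoprime Q s2) (cQ3 : IsCoprime Q s3)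
    (cQ4 : IsCoprime Q s4) (cQ6 : IsCoprime Q s6) (cQ8 : IsCoprime Q s8)
    (c5 : IsCoprime 5 s8)
    (g0 : 0 < Q ∨ 0 < s0) (g1 : 0 < s1) (g2 : 0 < -Q ∨ 0 < s2) (g3 : 0 < s3) (g4 : 0 < s4)
    (g5 : 0 < s5) (g7 : 0 < s7)
    (m0 : KJ s0 Q = 1) (m1 : KJ s1 Q = 1) (m2 : KJ s2 Q = KJ 3 Q) (m3 : KJ s3 Q = KJ 3 Q)
    (m4 : KJ s4 Q = KJ 3 Q) (m7 : KJ s0 7 = -1) (c7 : IsCoprime 7 s0) :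
    KJ 5 s8 = k2 r7 * ee r7 r8 * (k2 r6 * k3 r6 * ee r6 r7) * (k3 r5 * k2 r5 * ee r5 r6) *
      (km r4 * ee rQ r4 * k3 rQ * k3 r4 * ee r4 r5) * (km r3 * ee rQ r3 * k3 rQ * ee r3 r4) *
      (k3 r2 * ee (24 - rQ) r2 * k3 rQ * ee r2 r3) * (km r1 * k3 r1 * ee rQ r1 * ee r1 r2) *
      (-ee 7 r0 * ee rQ r0 * ee r0 r1) := by
  have n0 : IsCoprime (3 ^ 6 * p ^ 3 * Q ^ 5) s0 :=
    ((h0.cop3.pow_left).mul_left cp0.pow_left).mul_left cQ0.pow_left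
  have n1 : IsCoprime (-1 * 3 * p * Q) s1 :=
    (((isCoprime_one_left.neg_left).mul_left h1.cop3).mul_left cp1).mul_left cQ1
  have n2 : IsCoprime (3 * p * (-Q)) s2 := (h2.cop3.mul_left cp2).mul_left cQ2.neg_left
  have n3 : IsCoprime (-1 * 3 ^ 6 * p ^ 3) s3 :=
    ((isCoprime_one_left.neg_left).mul_left h3.cop3.pow_left).mul_left cp3.pow_left
  have n4 : IsCoprime (-1 * 2 ^ 2 * Q ^ 5) s4 :=
    ((isCoprime_one_left.neg_left).mul_left h4.cop2.pow_left).mul_left cQ4.pow_left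
  have n5 : IsCoprime (3 ^ 5 * p ^ 3) s5 := h5.cop3.pow_left.mul_left cp5.pow_left
  have n6 : IsCoprime (Q ^ 2) s6 := cQ6.pow_left
  have n7 : IsCoprime (3 ^ 4 * p ^ 2) s7 := h7.cop3.pow_left.mul_left cp7.pow_left
  have n8 : IsCoprime (Q ^ 2) s8 := cQ8.pow_left
  have d7 : IsCoprime s7 s8 := cop_step i8 n8 c5
  have d6 : IsCoprime s6 s7 := cop_step i7 n7 d7.symm
  have d5 : IsCoprime s5 s6 := cop_step i6 n6 d6.symm
  have d4 : IsCoprime s4 s5 := cop_step i5 n5 d5.symm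
  have d3 : IsCoprime s3 s4 := cop_step i4 n4 d4.symm
  have d2 : IsCoprime s2 s3 := cop_step i3 n3 d3.symm
  have d1 : IsCoprime s1 s2 := cop_step i2 n2 d2.symm
  have d0 : IsCoprime s0 s1 := cop_step i1 n1 d1.symm
  have hone : ∀ b, KJ 1 b = 1 := fun b => jacobiSym.one_left _
  have e8 := step i8 n8
  have e7 := step i7 n7
  have e6 := step i6 n6
  have e5 := step i5 n5
  have e4 := step i4 n4
  have e3 := step i3 n3
  have e2 := step i2 n2
  have e1 := step i1 n1
  have e0 : KJ s1 s0 = KJ (3 ^ 6 * p ^ 3 * Q ^ 5) s0 * KJ 7 s0 := by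
    have a1 : KJ (7 * z ^ 2) s0 = KJ ((3 ^ 6 * p ^ 3 * Q ^ 5) * s1) s0 := KJ_mod i0
    have a2 : IsCoprime ((3 ^ 6 * p ^ 3 * Q ^ 5) * s1) s0 := n0.mul_left d0.symm
    have a3 : KJ 7 s0 = KJ ((3 ^ 6 * p ^ 3 * Q ^ 5) * s1) s0 := by
      refine KJ_mul_sq a1 ?_
      intro h; have := KJ_sq a2; rw [h] at this; norm_num at this
    rw [a3, KJ_mul _ s1, ← mul_assoc, ← pow_two, KJ_sq n0, one_mul]
  have sq3Q : KJ 3 Q ^ 2 = 1 := KJ_sq hQ.cop3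
  have w7 : KJ 7 s0 = -ee 7 r0 := by
    have : Res 7 7 := by refine ⟨?_, ?_, ?_⟩ <;> norm_num
    rw [this.ee h0 (by norm_num) c7, m7]; ring
  have wQ0 : KJ Q s0 = ee rQ r0 := by rw [hQ.ee h0 g0 cQ0, m0, mul_one]
  have wQ1 : KJ Q s1 = ee rQ r1 := by rw [hQ.ee h1 (Or.inr g1) cQ1, m1, mul_one]
  have wQ2 : KJ (-Q) s2 = ee (24 - rQ) r2 * k3 rQ := by
    rw [hQ.neg.ee h2 g2 cQ2.neg_left, KJ_neg_right, m2, hQ.k3]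
  have wQ3 : KJ Q s3 = ee rQ r3 * k3 rQ := by rw [hQ.ee h3 (Or.inr g3) cQ3, m3, hQ.k3]
  have wQ4 : KJ Q s4 = ee rQ r4 * k3 rQ := by rw [hQ.ee h4 (Or.inr g4) cQ4, m4, hQ.k3]
  have sqs : ∀ a b : ℤ, IsCoprime a b → ∀ k : ℕ, KJ (a ^ (2 * k)) b = 1 := by
    intro a b h k; rw [KJ_pow, pow_mul, KJ_sq h, one_pow]
  rw [sqs Q s8 cQ8 1, hone, h7.ee h8 (Or.inl g7) d7, one_mul, one_mul, e7, KJ_mul,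
    sqs 3 s7 h7.cop3 2, KJ_pow p, KJ_p hp cp7, h7.k2, h6.ee h7 (Or.inr g7) d6, e6,
    sqs Q s6 cQ6 1, KJ_mul, h6.k2, h6.k3, h5.ee h6 (Or.inl g5) d5, e5, KJ_mul, KJ_pow p,
    KJ_p hp cp5, KJ_pow, h5.k3, h5.k2, h4.ee h5 (Or.inl g4) d4, e4, KJ_mul, KJ_mul, h4.km g4,
    sqs 2 s4 h4.cop2 1, KJ_pow Q, wQ4, KJ_mul, KJ_pow, h4.k3, KJ_pow p, KJ_p hp cp4,
    h3.ee h4 (Or.inl g3) d3, e3, KJ_mul, KJ_mul, h3.km g3, sqs 3 s3 h3.cop3 3, KJ_pow p,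
    KJ_p hp cp3, KJ_mul, sqs 2 s3 h3.cop2 1, wQ3, h2.ee h3 (Or.inr g3) d2, e2, KJ_mul, KJ_mul,
    h2.k3, KJ_p hp cp2, wQ2, hone, h1.ee h2 (Or.inl g1) d1, e1, KJ_mul, KJ_mul, KJ_mul,
    h1.km g1, h1.k3, KJ_p hp cp1, wQ1, hone, h0.ee h1 (Or.inr g1) d0, e0, KJ_mul, KJ_mul,
    sqs 3 s0 h0.cop3 3, KJ_pow p, KJ_p hp cp0, KJ_pow Q, wQ0, w7] at e8
  have z1 : ∀ a, k3 a * k3 a = 1 := by intro a; unfold k3; split_ifs <;> rfl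
  have z2 : ∀ a b, ee a b * ee a b = 1 := by intro a b; unfold ee; split_ifs <;> rfl
  have y5 : k3 r5 ^ 5 = k3 r5 := by
    linear_combination (k3 r5 ^ 3 + k3 r5) * z1 r5
  have y4 : k3 r4 ^ 3 = k3 r4 := by linear_combination (k3 r4) * z1 r4
  have y0 : ee rQ r0 ^ 5 = ee rQ r0 := by
    linear_combination (ee rQ r0 ^ 3 + ee rQ r0) * z2 rQ r0
  have yQ : (ee rQ r4 * k3 rQ) ^ 5 = ee rQ r4 * k3 rQ := by
    have : (ee rQ r4 * k3 rQ) * (ee rQ r4 * k3 rQ) = 1 := by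
      linear_combination z2 rQ r4 + (ee rQ r4) ^ 2 * z1 rQ
    linear_combination ((ee rQ r4 * k3 rQ) ^ 3 + (ee rQ r4 * k3 rQ)) * this
  rw [y5, y4, y0, yQ] at e8
  rw [e8]; ring

/-- The second, shorter chain. Here the auxiliary cubic `T` is even, so its power of two is split
off first; the parameters `a`, `b`, `c` allow us to run the same computation also after dividing
all forms by suitable powers of five. -/
lemma chainA {x p Q z : ℤ} {G T T2 U V q0 q1 q2 q3 a b c : ℤ} {k : ℕ}
    {g t u v rQ σ τ : ℤ} (hp : p = x ^ 2)
    (i0 : (3 ^ 5 * p ^ 3 * 7) * z ^ 2 = q0 * G + (-1 * 2 ^ 2 * Q ^ 17) * T)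
    (i1 : 1 * G = q1 * T + Q ^ 8 * (U * (-V)))
    (i2 : 1 * T = q2 * U + (c ^ 2 * 3 ^ 5) * p ^ 3)
    (i3 : (2 ^ 3 * a) * T = q3 * V + (b * 3 ^ 5) * p ^ 3)
    (hT : T = 2 ^ k * T2)
    (hG : Res G g) (hT2 : Res T2 t) (hU : Res U u) (hV : Res V v) (hQ : Res Q rQ)
    (cpG : IsCoprime p G) (cpU : IsCoprime p U) (cpV : IsCoprime p V)
    (cQG : IsCoprime Q G) (cQT : IsCoprime Q T)
    (ca : IsCoprime a V) (cb : IsCoprime b V) (cc : IsCoprime c U)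
    (gG : 0 < G) (gU : 0 < U) (gV : 0 < -V ∨ 0 < T2)
    (mG : KJ G Q = σ) (m7 : KJ G 7 = τ) (c7 : IsCoprime 7 G) :
    (k2 g * k2 u * k2 v) ^ k * ee t g * (ee u t * k3 u) *
      (ee (24 - v) t * k2 v * k3 v) * (KJ a V * KJ b V) =
      km g * (ee rQ g * σ) * k3 g * (ee 7 g * τ) := by
  have sqs : ∀ a b : ℤ, IsCoprime a b → ∀ k : ℕ, KJ (a ^ (2 * k)) b = 1 := by
    intro a b h k; rw [KJ_pow, pow_mul, KJ_sq h, one_pow]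
  have z3 : ∀ a, k3 a * k3 a = 1 := by intro a; unfold k3; split_ifs <;> rfl
  have z2 : ∀ a, k2 a * k2 a = 1 := by intro a; unfold k2; split_ifs <;> rfl
  have z2k : ∀ a, k2 a ^ k * k2 a ^ k = 1 := by intro a; rw [← mul_pow, z2, one_pow]
  have ze : ∀ a b, ee a b * ee a b = 1 := by intro a b; unfold ee; split_ifs <;> rfl
  have zm : ∀ a, km a * km a = 1 := by intro a; unfold km; split_ifs <;> rfl
  have y3 : ∀ a, k3 a ^ 5 = k3 a := by
    intro a; linear_combination (k3 a ^ 3 + k3 a) * z3 a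
  have dTU : IsCoprime T U :=
    cop_step i2 (cc.pow_left.mul_left hU.cop3.pow_left) cpU.pow_left
  have dTV : IsCoprime T V :=
    cop_step i3 (cb.mul_left hV.cop3.pow_left) cpV.pow_left
  have tU : IsCoprime T2 U := by rw [hT] at dTU; exact dTU.of_mul_left_right
  have tV : IsCoprime T2 V := by rw [hT] at dTV; exact dTV.of_mul_left_right
  have tQ : IsCoprime Q T2 := by rw [hT] at cQT; exact cQT.of_mul_right_right
  have i1' : 1 * G = (q1 * 2 ^ k) * T2 + Q ^ 8 * (U * (-V)) := by
    rw [i1, hT]; ring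
  have dG : IsCoprime G T2 :=
    cop_step i1' tQ.pow_left (tU.symm.mul_left tV.symm.neg_left)
  have dGT : IsCoprime T G := by rw [hT]; exact hG.cop2.pow_left.mul_left dG.symm
  have eU : KJ T2 U = k2 u ^ k * k3 u := by
    have h1 := KJ_mod i2
    rw [one_mul, KJ_mul, KJ_mul, sqs c U cc 1, KJ_pow, hU.k3, KJ_pow, KJ_p hp cpU, hT,
      KJ_mul, KJ_pow, hU.k2, y3] at h1
    linear_combination (k2 u ^ k) * h1 - KJ T2 U * z2k u
  have eV : KJ T2 V = k2 v ^ k * (k2 v * KJ a V * KJ b V * k3 v) := by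
    have h1 := KJ_mod i3
    have h2 := KJ_sq ca
    rw [KJ_mul, KJ_mul, KJ_mul, KJ_mul, KJ_pow, hV.k2, KJ_pow, hV.k3, KJ_pow, KJ_p hp cpV, hT,
      KJ_mul, KJ_pow, hV.k2, y3] at h1
    have h3 : k2 v ^ 3 = k2 v := by linear_combination (k2 v) * z2 v
    rw [h3] at h1
    linear_combination (k2 v ^ k * k2 v * KJ a V) * h1 - KJ T2 V * z2k v
      - KJ T2 V * k2 v ^ k * k2 v ^ k * z2 v
      - KJ T2 V * k2 v ^ k * k2 v ^ k * k2 v * k2 v * h2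
  have eG : KJ G T2 = KJ U T2 * KJ (-V) T2 := by
    have h1 := KJ_mod i1'
    rw [one_mul, KJ_mul, KJ_mul, sqs Q T2 tQ 4, one_mul] at h1
    exact h1
  rw [hU.ee hT2 (Or.inl gU) tU.symm, hV.neg.ee hT2 gV tV.symm.neg_left, KJ_neg_right, eU, eV] at eG
  have e0 : KJ (3 ^ 5 * p ^ 3 * 7) G = KJ ((-1 * 2 ^ 2 * Q ^ 17) * T) G := by
    refine KJ_mul_sq (KJ_mod i0) ?_
    have a2 : IsCoprime ((-1 * 2 ^ 2 * Q ^ 17) * T) G :=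
      (((isCoprime_one_left.neg_left).mul_left hG.cop2.pow_left).mul_left
        cQG.pow_left).mul_left dGT
    intro h; have := KJ_sq a2; rw [h] at this; norm_num at this
  have w7 : KJ 7 G = ee 7 g * τ := by
    have : Res 7 7 := by refine ⟨?_, ?_, ?_⟩ <;> norm_num
    rw [this.ee hG (by norm_num) c7, m7]
  have wQ : KJ Q G = ee rQ g * σ := by rw [hQ.ee hG (Or.inr gG) cQG, mG]
  have wQ17 : KJ Q G ^ 17 = KJ Q G := by
    have h := KJ_sq cQG
    have : KJ Q G ^ 17 = (KJ Q G ^ 2) ^ 8 * KJ Q G := by ring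
    rw [this, h]; ring
  rw [KJ_mul, KJ_mul, KJ_pow, hG.k3, y3, KJ_pow, KJ_p hp cpG, w7, KJ_mul, KJ_mul, KJ_mul,
    hG.km gG, sqs 2 G hG.cop2 1, KJ_pow, wQ17, wQ, hT, KJ_mul, KJ_pow, hG.k2,
    hT2.ee hG (Or.inr gG) dG.symm, eG] at e0
  have hσ : (ee rQ g * σ) ^ 2 = 1 := by rw [← wQ]; exact KJ_sq cQG
  rw [mul_pow, mul_pow]
  linear_combination (-(km g * (ee rQ g * σ))) * e0 - (k2 g ^ k * k2 u ^ k * k2 v ^ k * ee t g * (ee u t * k3 u) *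
      (ee (24 - v) t * k2 v * k3 v) * (KJ a V * KJ b V)) * (zm g * (ee rQ g * σ) ^ 2 + hσ)

/-- Positivity of the binary forms of the first chain, for negative and for positive second variable.
Each proof covers the cone by subcones on which, after a unimodular change of variables, every
coefficient becomes nonnegative. -/
lemma posN0 (P Q : ℤ) (hP : 0 < P) (hQ : Q < 0) : 0 < 18 * Q ^ 10 - 6 * P ^ 4 * Q ^ 6 - 3 * P ^ 5 * Q ^ 5 - 3 * P ^ 6 * Q ^ 4 + 1 * P ^ 10 := by
  rcases lt_or_ge 0 (-1 * P - 1 * Q) with hv | hv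
  · obtain ⟨v, hv'⟩ : ∃ v, v = (-1 * P - 1 * Q) := ⟨_, rfl⟩
    obtain ⟨w, hw'⟩ : ∃ w, w = (1 * P + 0 * Q) := ⟨_, rfl⟩
    have h1 : 0 < v := by linarith
    have h2 : 0 ≤ w := by linarith
    have e1 : P = 0 * v + 1 * w := by rw [hv', hw']; ring
    have e2 : Q = -1 * v + -1 * w := by rw [hv', hw']; ring
    have e3 : 18 * Q ^ 10 - 6 * P ^ 4 * Q ^ 6 - 3 * P ^ 5 * Q ^ 5 - 3 * P ^ 6 * Q ^ 4 + 1 * P ^ 10 = 18 * v ^ 10 + 180 * w ^ 1 * v ^ 9 + 810 * w ^ 2 * v ^ 8 + 2160 * w ^ 3 * v ^ 7 + 3774 * w ^ 4 * v ^ 6 + 4503 * w ^ 5 * v ^ 5 + 3702 * w ^ 6 * v ^ 4 + 2058 * w ^ 7 * v ^ 3 + 732 * w ^ 8 * v ^ 2 + 147 * w ^ 9 * v ^ 1 + 13 * w ^ 10 := by rw [e1, e2]; ring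
    rw [e3]; positivity
  rcases lt_or_ge 0 (-1 * P - 2 * Q) with hv | hv
  · obtain ⟨v, hv'⟩ : ∃ v, v = (-1 * P - 2 * Q) := ⟨_, rfl⟩
    obtain ⟨w, hw'⟩ : ∃ w, w = (1 * P + 1 * Q) := ⟨_, rfl⟩
    have h1 : 0 < v := by linarith
    have h2 : 0 ≤ w := by linarith
    have e1 : P = 1 * v + 2 * w := by rw [hv', hw']; ring
    have e2 : Q = -1 * v + -1 * w := by rw [hv', hw']; ring
    have e3 : 18 * Q ^ 10 - 6 * P ^ 4 * Q ^ 6 - 3 * P ^ 5 * Q ^ 5 - 3 * P ^ 6 * Q ^ 4 + 1 * P ^ 10 = 13 * v ^ 10 + 113 * w ^ 1 * v ^ 9 + 426 * w ^ 2 * v ^ 8 + 966 * w ^ 3 * v ^ 7 + 1770 * w ^ 4 * v ^ 6 + 3465 * w ^ 5 * v ^ 5 + 6480 * w ^ 6 * v ^ 4 + 8904 * w ^ 7 * v ^ 3 + 7818 * w ^ 8 * v ^ 2 + 3908 * w ^ 9 * v ^ 1 + 850 * w ^ 10 := by rw [e1, e2]; ring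
    rw [e3]; positivity
  obtain ⟨v, hv'⟩ : ∃ v, v = (0 * P - 1 * Q) := ⟨_, rfl⟩
  obtain ⟨w, hw'⟩ : ∃ w, w = (1 * P + 2 * Q) := ⟨_, rfl⟩
  have h1 : 0 < v := by linarith
  have h2 : 0 ≤ w := by linarith
  have e1 : P = 2 * v + 1 * w := by rw [hv', hw']; ring
  have e2 : Q = -1 * v + 0 * w := by rw [hv', hw']; ring
  have e3 : 18 * Q ^ 10 - 6 * P ^ 4 * Q ^ 6 - 3 * P ^ 5 * Q ^ 5 - 3 * P ^ 6 * Q ^ 4 + 1 * P ^ 10 = 850 * v ^ 10 + 4592 * w ^ 1 * v ^ 9 + 10896 * w ^ 2 * v ^ 8 + 14952 * w ^ 3 * v ^ 7 + 13284 * w ^ 4 * v ^ 6 + 8031 * w ^ 5 * v ^ 5 + 3357 * w ^ 6 * v ^ 4 + 960 * w ^ 7 * v ^ 3 + 180 * w ^ 8 * v ^ 2 + 20 * w ^ 9 * v ^ 1 + 1 * w ^ 10 := by rw [e1, e2]; ring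
  rw [e3]; positivity

lemma posN1 (P Q : ℤ) (hP : 0 < P) (hQ : Q < 0) : 0 < - 18 * Q ^ 9 - 12 * P ^ 1 * Q ^ 8 - 6 * P ^ 2 * Q ^ 7 - 6 * P ^ 3 * Q ^ 6 + 3 * P ^ 5 * Q ^ 4 + 3 * P ^ 6 * Q ^ 3 + 2 * P ^ 7 * Q ^ 2 + 2 * P ^ 8 * Q ^ 1 + 1 * P ^ 9 := by
  rcases lt_or_ge 0 (-1 * P - 1 * Q) with hv | hv
  · obtain ⟨v, hv'⟩ : ∃ v, v = (-1 * P - 1 * Q) := ⟨_, rfl⟩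
    obtain ⟨w, hw'⟩ : ∃ w, w = (1 * P + 0 * Q) := ⟨_, rfl⟩
    have h1 : 0 < v := by linarith
    have h2 : 0 ≤ w := by linarith
    have e1 : P = 0 * v + 1 * w := by rw [hv', hw']; ring
    have e2 : Q = -1 * v + -1 * w := by rw [hv', hw']; ring
    have e3 : - 18 * Q ^ 9 - 12 * P ^ 1 * Q ^ 8 - 6 * P ^ 2 * Q ^ 7 - 6 * P ^ 3 * Q ^ 6 + 3 * P ^ 5 * Q ^ 4 + 3 * P ^ 6 * Q ^ 3 + 2 * P ^ 7 * Q ^ 2 + 2 * P ^ 8 * Q ^ 1 + 1 * P ^ 9 = 18 * v ^ 9 + 150 * w ^ 1 * v ^ 8 + 558 * w ^ 2 * v ^ 7 + 1212 * w ^ 3 * v ^ 6 + 1686 * w ^ 4 * v ^ 5 + 1551 * w ^ 5 * v ^ 4 + 939 * w ^ 6 * v ^ 3 + 359 * w ^ 7 * v ^ 2 + 77 * w ^ 8 * v ^ 1 + 7 * w ^ 9 := by rw [e1, e2]; ring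
    rw [e3]; positivity
  rcases lt_or_ge 0 (-2 * P - 3 * Q) with hv | hv
  · obtain ⟨v, hv'⟩ : ∃ v, v = (-2 * P - 3 * Q) := ⟨_, rfl⟩
    obtain ⟨w, hw'⟩ : ∃ w, w = (1 * P + 1 * Q) := ⟨_, rfl⟩
    have h1 : 0 < v := by linarith
    have h2 : 0 ≤ w := by linarith
    have e1 : P = 1 * v + 3 * w := by rw [hv', hw']; ring
    have e2 : Q = -1 * v + -2 * w := by rw [hv', hw']; ring
    have e3 : - 18 * Q ^ 9 - 12 * P ^ 1 * Q ^ 8 - 6 * P ^ 2 * Q ^ 7 - 6 * P ^ 3 * Q ^ 6 + 3 * P ^ 5 * Q ^ 4 + 3 * P ^ 6 * Q ^ 3 + 2 * P ^ 7 * Q ^ 2 + 2 * P ^ 8 * Q ^ 1 + 1 * P ^ 9 = 7 * v ^ 9 + 112 * w ^ 1 * v ^ 8 + 779 * w ^ 2 * v ^ 7 + 3072 * w ^ 3 * v ^ 6 + 7518 * w ^ 4 * v ^ 5 + 11805 * w ^ 5 * v ^ 4 + 12111 * w ^ 6 * v ^ 3 + 8568 * w ^ 7 * v ^ 2 + 4659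 * w ^ 8 * v ^ 1 + 1647 * w ^ 9 := by rw [e1, e2]; ring
    rw [e3]; positivity
  rcases lt_or_ge 0 (-1 * P - 2 * Q) with hv | hv
  · obtain ⟨v, hv'⟩ : ∃ v, v = (-1 * P - 2 * Q) := ⟨_, rfl⟩
    obtain ⟨w, hw'⟩ : ∃ w, w = (2 * P + 3 * Q) := ⟨_, rfl⟩
    have h1 : 0 < v := by linarith
    have h2 : 0 ≤ w := by linarith
    have e1 : P = 3 * v + 2 * w := by rw [hv', hw']; ring
    have e2 : Q = -2 * v + -1 * w := by rw [hv', hw']; ring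
    have e3 : - 18 * Q ^ 9 - 12 * P ^ 1 * Q ^ 8 - 6 * P ^ 2 * Q ^ 7 - 6 * P ^ 3 * Q ^ 6 + 3 * P ^ 5 * Q ^ 4 + 3 * P ^ 6 * Q ^ 3 + 2 * P ^ 7 * Q ^ 2 + 2 * P ^ 8 * Q ^ 1 + 1 * P ^ 9 = 1647 * v ^ 9 + 10164 * w ^ 1 * v ^ 8 + 30588 * w ^ 2 * v ^ 7 + 55761 * w ^ 3 * v ^ 6 + 65685 * w ^ 4 * v ^ 5 + 51114 * w ^ 5 * v ^ 4 + 26154 * w ^ 6 * v ^ 3 + 8482 * w ^ 7 * v ^ 2 + 1584 * w ^ 8 * v ^ 1 + 130 * w ^ 9 := by rw [e1, e2]; ring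
    rw [e3]; positivity
  obtain ⟨v, hv'⟩ : ∃ v, v = (0 * P - 1 * Q) := ⟨_, rfl⟩
  obtain ⟨w, hw'⟩ : ∃ w, w = (1 * P + 2 * Q) := ⟨_, rfl⟩
  have h1 : 0 < v := by linarith
  have h2 : 0 ≤ w := by linarith
  have e1 : P = 2 * v + 1 * w := by rw [hv', hw']; ring
  have e2 : Q = -1 * v + 0 * w := by rw [hv', hw']; ring
  have e3 : - 18 * Q ^ 9 - 12 * P ^ 1 * Q ^ 8 - 6 * P ^ 2 * Q ^ 7 - 6 * P ^ 3 * Q ^ 6 + 3 * P ^ 5 * Q ^ 4 + 3 * P ^ 6 * Q ^ 3 + 2 * P ^ 7 * Q ^ 2 + 2 * P ^ 8 * Q ^ 1 + 1 * P ^ 9 = 130 * v ^ 9 + 756 * w ^ 1 * v ^ 8 + 1858 * w ^ 2 * v ^ 7 + 2546 * w ^ 3 * v ^ 6 + 2202 * w ^ 4 * v ^ 5 + 1255 * w ^ 5 * v ^ 4 + 473 * w ^ 6 * v ^ 3 + 114 * w ^ 7 * v ^ 2 + 16 * w ^ 8 * v ^ 1 + 1 * w ^ 9 := by rw [e1, e2];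 ring
  rw [e3]; positivity
lemma posP1 (P Q : ℤ) (hQ : 0 < Q) (h : 13 * Q < 10 * P) : 0 < - 18 * Q ^ 9 - 12 * P ^ 1 * Q ^ 8 - 6 * P ^ 2 * Q ^ 7 - 6 * P ^ 3 * Q ^ 6 + 3 * P ^ 5 * Q ^ 4 + 3 * P ^ 6 * Q ^ 3 + 2 * P ^ 7 * Q ^ 2 + 2 * P ^ 8 * Q ^ 1 + 1 * P ^ 9 := by
  obtain ⟨w, hw'⟩ : ∃ w, w = 10 * P - 13 * Q := ⟨_, rfl⟩
  have h2 : 0 < w := by linarith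
  have e3 : 1000000000 * (- 18 * Q ^ 9 - 12 * P ^ 1 * Q ^ 8 - 6 * P ^ 2 * Q ^ 7 - 6 * P ^ 3 * Q ^ 6 + 3 * P ^ 5 * Q ^ 4 + 3 * P ^ 6 * Q ^ 3 + 2 * P ^ 7 * Q ^ 2 + 2 * P ^ 8 * Q ^ 1 + 1 * P ^ 9) = 8166034193 * Q ^ 9 + 29304295809 * w ^ 1 * Q ^ 8 + 8171735252 * w ^ 2 * Q ^ 7 + 1197747116 * w ^ 3 * Q ^ 6 + 111702318 * w ^ 4 * Q ^ 5 + 7033126 * w ^ 5 * Q ^ 4 + 300388 * w ^ 6 * Q ^ 3 + 8364 * w ^ 7 * Q ^ 2 + 137 * w ^ 8 * Q ^ 1 + 1 * w ^ 9 := by rw [hw']; ring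
  have e4 : 0 < 8166034193 * Q ^ 9 + 29304295809 * w ^ 1 * Q ^ 8 + 8171735252 * w ^ 2 * Q ^ 7 + 1197747116 * w ^ 3 * Q ^ 6 + 111702318 * w ^ 4 * Q ^ 5 + 7033126 * w ^ 5 * Q ^ 4 + 300388 * w ^ 6 * Q ^ 3 + 8364 * w ^ 7 * Q ^ 2 + 137 * w ^ 8 * Q ^ 1 + 1 * w ^ 9 := by positivity
  linarith

lemma posP2 (P Q : ℤ) (hQ : 0 < Q) (h : 13 * Q < 10 * P) : 0 < - 6 * Q ^ 8 - 6 * P ^ 1 * Q ^ 7 + 3 * P ^ 5 * Q ^ 3 + 1 * P ^ 6 * Q ^ 2 + 1 * P ^ 8 := by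
  obtain ⟨w, hw'⟩ : ∃ w, w = 10 * P - 13 * Q := ⟨_, rfl⟩
  have h2 : 0 < w := by linarith
  have e3 : 100000000 * (- 6 * Q ^ 8 - 6 * P ^ 1 * Q ^ 7 + 3 * P ^ 5 * Q ^ 3 + 1 * P ^ 6 * Q ^ 2 + 1 * P ^ 8) = 1032290621 * Q ^ 8 + 1093178936 * w ^ 1 * Q ^ 7 + 243902152 * w ^ 2 * Q ^ 6 + 30256408 * w ^ 3 * Q ^ 5 + 2447770 * w ^ 4 * Q ^ 4 + 133832 * w ^ 5 * Q ^ 3 + 4832 * w ^ 6 * Q ^ 2 + 104 * w ^ 7 * Q ^ 1 + 1 * w ^ 8 := by rw [hw']; ring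
  have e4 : 0 < 1032290621 * Q ^ 8 + 1093178936 * w ^ 1 * Q ^ 7 + 243902152 * w ^ 2 * Q ^ 6 + 30256408 * w ^ 3 * Q ^ 5 + 2447770 * w ^ 4 * Q ^ 4 + 133832 * w ^ 5 * Q ^ 3 + 4832 * w ^ 6 * Q ^ 2 + 104 * w ^ 7 * Q ^ 1 + 1 * w ^ 8 := by positivity
  linarith

lemma posN3 (P Q : ℤ) (hP : 0 < P) (hQ : Q < 0) : 0 < - 12 * Q ^ 7 + 6 * P ^ 2 * Q ^ 5 + 6 * P ^ 4 * Q ^ 3 + 3 * P ^ 5 * Q ^ 2 - 1 * P ^ 6 * Q ^ 1 + 1 * P ^ 7 := by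
  rcases lt_or_ge 0 (-1 * P - 1 * Q) with hv | hv
  · obtain ⟨v, hv'⟩ : ∃ v, v = (-1 * P - 1 * Q) := ⟨_, rfl⟩
    obtain ⟨w, hw'⟩ : ∃ w, w = (1 * P + 0 * Q) := ⟨_, rfl⟩
    have h1 : 0 < v := by linarith
    have h2 : 0 ≤ w := by linarith
    have e1 : P = 0 * v + 1 * w := by rw [hv', hw']; ring
    have e2 : Q = -1 * v + -1 * w := by rw [hv', hw']; ring
    have e3 : - 12 * Q ^ 7 + 6 * P ^ 2 * Q ^ 5 + 6 * P ^ 4 * Q ^ 3 + 3 * P ^ 5 * Q ^ 2 - 1 * P ^ 6 * Q ^ 1 + 1 * P ^ 7 = 12 * v ^ 7 + 84 * w ^ 1 * v ^ 6 + 246 * w ^ 2 * v ^ 5 + 390 * w ^ 3 * v ^ 4 + 354 * w ^ 4 * v ^ 3 + 177 * w ^ 5 * v ^ 2 + 43 * w ^ 6 * v ^ 1 + 5 * w ^ 7 := by rw [e1, e2]; ring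
    rw [e3]; positivity
  rcases lt_or_ge 0 (-1 * P - 2 * Q) with hv | hv
  · obtain ⟨v, hv'⟩ : ∃ v, v = (-1 * P - 2 * Q) := ⟨_, rfl⟩
    obtain ⟨w, hw'⟩ : ∃ w, w = (1 * P + 1 * Q) := ⟨_, rfl⟩
    have h1 : 0 < v := by linarith
    have h2 : 0 ≤ w := by linarith
    have e1 : P = 1 * v + 2 * w := by rw [hv', hw']; ring
    have e2 : Q = -1 * v + -1 * w := by rw [hv', hw']; ring
    have e3 : - 12 * Q ^ 7 + 6 * P ^ 2 * Q ^ 5 + 6 * P ^ 4 * Q ^ 3 + 3 * P ^ 5 * Q ^ 2 - 1 * P ^ 6 * Q ^ 1 + 1 * P ^ 7 = 5 * v ^ 7 + 27 * w ^ 1 * v ^ 6 + 81 * w ^ 2 * v ^ 5 + 236 * w ^ 3 * v ^ 4 + 558 * w ^ 4 * v ^ 3 + 798 * w ^ 5 * v ^ 2 + 596 * w ^ 6 * v ^ 1 + 180 * w ^ 7 := by rw [e1, e2]; ring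
    rw [e3]; positivity
  obtain ⟨v, hv'⟩ : ∃ v, v = (0 * P - 1 * Q) := ⟨_, rfl⟩
  obtain ⟨w, hw'⟩ : ∃ w, w = (1 * P + 2 * Q) := ⟨_, rfl⟩
  have h1 : 0 < v := by linarith
  have h2 : 0 ≤ w := by linarith
  have e1 : P = 2 * v + 1 * w := by rw [hv', hw']; ring
  have e2 : Q = -1 * v + 0 * w := by rw [hv', hw']; ring
  have e3 : - 12 * Q ^ 7 + 6 * P ^ 2 * Q ^ 5 + 6 * P ^ 4 * Q ^ 3 + 3 * P ^ 5 * Q ^ 2 - 1 * P ^ 6 * Q ^ 1 + 1 * P ^ 7 = 180 * v ^ 7 + 664 * w ^ 1 * v ^ 6 + 1002 * w ^ 2 * v ^ 5 + 792 * w ^ 3 * v ^ 4 + 364 * w ^ 4 * v ^ 3 + 99 * w ^ 5 * v ^ 2 + 15 * w ^ 6 * v ^ 1 + 1 * w ^ 7 := by rw [e1, e2]; ring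
  rw [e3]; positivity
lemma posP3 (P Q : ℤ) (hQ : 0 < Q) (h : 13 * Q < 10 * P) : 0 < - 12 * Q ^ 7 + 6 * P ^ 2 * Q ^ 5 + 6 * P ^ 4 * Q ^ 3 + 3 * P ^ 5 * Q ^ 2 - 1 * P ^ 6 * Q ^ 1 + 1 * P ^ 7 := by
  obtain ⟨w, hw'⟩ : ∃ w, w = 10 * P - 13 * Q := ⟨_, rfl⟩
  have h2 : 0 < w := by linarith
  have e3 : 10000000 * (- 12 * Q ^ 7 + 6 * P ^ 2 * Q ^ 5 + 6 * P ^ 4 * Q ^ 3 + 3 * P ^ 5 * Q ^ 2 - 1 * P ^ 6 * Q ^ 1 + 1 * P ^ 7) = 278634327 * Q ^ 7 + 122679583 * w ^ 1 * Q ^ 6 + 16788003 * w ^ 2 * Q ^ 5 + 1379235 * w ^ 3 * Q ^ 4 + 77045 * w ^ 4 * Q ^ 3 + 3069 * w ^ 5 * Q ^ 2 + 81 * w ^ 6 * Q ^ 1 + 1 * w ^ 7 := by rw [hw']; ring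
  have e4 : 0 < 278634327 * Q ^ 7 + 122679583 * w ^ 1 * Q ^ 6 + 16788003 * w ^ 2 * Q ^ 5 + 1379235 * w ^ 3 * Q ^ 4 + 77045 * w ^ 4 * Q ^ 3 + 3069 * w ^ 5 * Q ^ 2 + 81 * w ^ 6 * Q ^ 1 + 1 * w ^ 7 := by positivity
  linarith

lemma posN4 (P Q : ℤ) (hP : 0 < P) (hQ : Q < 0) : 0 < 12 * Q ^ 6 + 18 * P ^ 1 * Q ^ 5 + 6 * P ^ 2 * Q ^ 4 + 6 * P ^ 3 * Q ^ 3 + 3 * P ^ 4 * Q ^ 2 - 3 * P ^ 5 * Q ^ 1 + 1 * P ^ 6 := by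
  rcases lt_or_ge 0 (-2 * P - 1 * Q) with hv | hv
  · obtain ⟨v, hv'⟩ : ∃ v, v = (-2 * P - 1 * Q) := ⟨_, rfl⟩
    obtain ⟨w, hw'⟩ : ∃ w, w = (1 * P + 0 * Q) := ⟨_, rfl⟩
    have h1 : 0 < v := by linarith
    have h2 : 0 ≤ w := by linarith
    have e1 : P = 0 * v + 1 * w := by rw [hv', hw']; ring
    have e2 : Q = -1 * v + -2 * w := by rw [hv', hw']; ring
    have e3 : 12 * Q ^ 6 + 18 * P ^ 1 * Q ^ 5 + 6 * P ^ 2 * Q ^ 4 + 6 * P ^ 3 * Q ^ 3 + 3 * P ^ 4 * Q ^ 2 - 3 * P ^ 5 * Q ^ 1 + 1 * P ^ 6 = 12 * v ^ 6 + 126 * w ^ 1 * v ^ 5 + 546 * w ^ 2 * v ^ 4 + 1242 * w ^ 3 * v ^ 3 + 1551 * w ^ 4 * v ^ 2 + 999 * w ^ 5 * v ^ 1 + 259 * w ^ 6 := by rw [e1, e2]; ring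
    rw [e3]; positivity
  rcases lt_or_ge 0 (-1 * P - 1 * Q) with hv | hv
  · obtain ⟨v, hv'⟩ : ∃ v, v = (-1 * P - 1 * Q) := ⟨_, rfl⟩
    obtain ⟨w, hw'⟩ : ∃ w, w = (2 * P + 1 * Q) := ⟨_, rfl⟩
    have h1 : 0 < v := by linarith
    have h2 : 0 ≤ w := by linarith
    have e1 : P = 1 * v + 1 * w := by rw [hv', hw']; ring
    have e2 : Q = -2 * v + -1 * w := by rw [hv', hw']; ring
    have e3 : 12 * Q ^ 6 + 18 * P ^ 1 * Q ^ 5 + 6 * P ^ 2 * Q ^ 4 + 6 * P ^ 3 * Q ^ 3 + 3 * P ^ 4 * Q ^ 2 - 3 * P ^ 5 * Q ^ 1 + 1 * P ^ 6 = 259 * v ^ 6 + 555 * w ^ 1 * v ^ 5 + 441 * w ^ 2 * v ^ 4 + 152 * w ^ 3 * v ^ 3 + 21 * w ^ 4 * v ^ 2 + 3 * w ^ 5 * v ^ 1 + 1 * w ^ 6 := by rw [e1, e2]; ring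
    rw [e3]; positivity
  obtain ⟨v, hv'⟩ : ∃ v, v = (0 * P - 1 * Q) := ⟨_, rfl⟩
  obtain ⟨w, hw'⟩ : ∃ w, w = (1 * P + 1 * Q) := ⟨_, rfl⟩
  have h1 : 0 < v := by linarith
  have h2 : 0 ≤ w := by linarith
  have e1 : P = 1 * v + 1 * w := by rw [hv', hw']; ring
  have e2 : Q = -1 * v + 0 * w := by rw [hv', hw']; ring
  have e3 : 12 * Q ^ 6 + 18 * P ^ 1 * Q ^ 5 + 6 * P ^ 2 * Q ^ 4 + 6 * P ^ 3 * Q ^ 3 + 3 * P ^ 4 * Q ^ 2 - 3 * P ^ 5 * Q ^ 1 + 1 * P ^ 6 = 1 * v ^ 6 + 9 * w ^ 1 * v ^ 5 + 51 * w ^ 2 * v ^ 4 + 56 * w ^ 3 * v ^ 3 + 33 * w ^ 4 * v ^ 2 + 9 * w ^ 5 * v ^ 1 + 1 * w ^ 6 := by rw [e1, e2]; ring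
  rw [e3]; positivity
lemma posP4 (P Q : ℤ) (hQ : 0 < Q) (h : 13 * Q < 10 * P) : 0 < 12 * Q ^ 6 + 18 * P ^ 1 * Q ^ 5 + 6 * P ^ 2 * Q ^ 4 + 6 * P ^ 3 * Q ^ 3 + 3 * P ^ 4 * Q ^ 2 - 3 * P ^ 5 * Q ^ 1 + 1 * P ^ 6 := by
  obtain ⟨w, hw'⟩ : ∃ w, w = 10 * P - 13 * Q := ⟨_, rfl⟩
  have h2 : 0 < w := by linarith
  have e3 : 1000000 * (12 * Q ^ 6 + 18 * P ^ 1 * Q ^ 5 + 6 * P ^ 2 * Q ^ 4 + 6 * P ^ 3 * Q ^ 3 + 3 * P ^ 4 * Q ^ 2 - 3 * P ^ 5 * Q ^ 1 + 1 * P ^ 6) = 60978319 * Q ^ 6 + 6982008 * w ^ 1 * Q ^ 5 + 367515 * w ^ 2 * Q ^ 4 + 14840 * w ^ 3 * Q ^ 3 + 885 * w ^ 4 * Q ^ 2 + 48 * w ^ 5 * Q ^ 1 + 1 * w ^ 6 := by rw [hw']; ring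
  have e4 : 0 < 60978319 * Q ^ 6 + 6982008 * w ^ 1 * Q ^ 5 + 367515 * w ^ 2 * Q ^ 4 + 14840 * w ^ 3 * Q ^ 3 + 885 * w ^ 4 * Q ^ 2 + 48 * w ^ 5 * Q ^ 1 + 1 * w ^ 6 := by positivity
  linarith

lemma posN5 (P Q : ℤ) (hP : 0 < P) (hQ : Q < 0) : 0 < 12 * Q ^ 4 + 24 * P ^ 1 * Q ^ 3 + 18 * P ^ 2 * Q ^ 2 + 13 * P ^ 3 * Q ^ 1 + 8 * P ^ 4 := by
  rcases lt_or_ge 0 (-2 * P - 1 * Q) with hv | hv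
  · obtain ⟨v, hv'⟩ : ∃ v, v = (-2 * P - 1 * Q) := ⟨_, rfl⟩
    obtain ⟨w, hw'⟩ : ∃ w, w = (1 * P + 0 * Q) := ⟨_, rfl⟩
    have h1 : 0 < v := by linarith
    have h2 : 0 ≤ w := by linarith
    have e1 : P = 0 * v + 1 * w := by rw [hv', hw']; ring
    have e2 : Q = -1 * v + -2 * w := by rw [hv', hw']; ring
    have e3 : 12 * Q ^ 4 + 24 * P ^ 1 * Q ^ 3 + 18 * P ^ 2 * Q ^ 2 + 13 * P ^ 3 * Q ^ 1 + 8 * P ^ 4 = 12 * v ^ 4 + 72 * w ^ 1 * v ^ 3 + 162 * w ^ 2 * v ^ 2 + 155 * w ^ 3 * v ^ 1 + 54 * w ^ 4 := by rw [e1, e2]; ring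
    rw [e3]; positivity
  rcases lt_or_ge 0 (-1 * P - 1 * Q) with hv | hv
  · obtain ⟨v, hv'⟩ : ∃ v, v = (-1 * P - 1 * Q) := ⟨_, rfl⟩
    obtain ⟨w, hw'⟩ : ∃ w, w = (2 * P + 1 * Q) := ⟨_, rfl⟩
    have h1 : 0 < v := by linarith
    have h2 : 0 ≤ w := by linarith
    have e1 : P = 1 * v + 1 * w := by rw [hv', hw']; ring
    have e2 : Q = -2 * v + -1 * w := by rw [hv', hw']; ring
    have e3 : 12 * Q ^ 4 + 24 * P ^ 1 * Q ^ 3 + 18 * P ^ 2 * Q ^ 2 + 13 * P ^ 3 * Q ^ 1 + 8 * P ^ 4 = 54 * v ^ 4 + 61 * w ^ 1 * v ^ 3 + 21 * w ^ 2 * v ^ 2 + 3 * w ^ 3 * v ^ 1 + 1 * w ^ 4 := by rw [e1, e2]; ring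
    rw [e3]; positivity
  obtain ⟨v, hv'⟩ : ∃ v, v = (0 * P - 1 * Q) := ⟨_, rfl⟩
  obtain ⟨w, hw'⟩ : ∃ w, w = (1 * P + 1 * Q) := ⟨_, rfl⟩
  have h1 : 0 < v := by linarith
  have h2 : 0 ≤ w := by linarith
  have e1 : P = 1 * v + 1 * w := by rw [hv', hw']; ring
  have e2 : Q = -1 * v + 0 * w := by rw [hv', hw']; ring
  have e3 : 12 * Q ^ 4 + 24 * P ^ 1 * Q ^ 3 + 18 * P ^ 2 * Q ^ 2 + 13 * P ^ 3 * Q ^ 1 + 8 * P ^ 4 = 1 * v ^ 4 + 5 * w ^ 1 * v ^ 3 + 27 * w ^ 2 * v ^ 2 + 19 * w ^ 3 * v ^ 1 + 8 * w ^ 4 := by rw [e1, e2]; ring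
  rw [e3]; positivity
lemma posP5 (P Q : ℤ) (hQ : 0 < Q) (h : 13 * Q < 10 * P) : 0 < 12 * Q ^ 4 + 24 * P ^ 1 * Q ^ 3 + 18 * P ^ 2 * Q ^ 2 + 13 * P ^ 3 * Q ^ 1 + 8 * P ^ 4 := by
  obtain ⟨w, hw'⟩ : ∃ w, w = 10 * P - 13 * Q := ⟨_, rfl⟩
  have h2 : 0 < w := by linarith
  have e3 : 10000 * (12 * Q ^ 4 + 24 * P ^ 1 * Q ^ 3 + 18 * P ^ 2 * Q ^ 2 + 13 * P ^ 3 * Q ^ 1 + 8 * P ^ 4) = 1250298 * Q ^ 4 + 207014 * w ^ 1 * Q ^ 3 + 14982 * w ^ 2 * Q ^ 2 + 546 * w ^ 3 * Q ^ 1 + 8 * w ^ 4 := by rw [hw']; ring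
  have e4 : 0 < 1250298 * Q ^ 4 + 207014 * w ^ 1 * Q ^ 3 + 14982 * w ^ 2 * Q ^ 2 + 546 * w ^ 3 * Q ^ 1 + 8 * w ^ 4 := by positivity
  linarith

lemma posN7 (P Q : ℤ) (hP : 0 < P) (hQ : Q < 0) : 0 < 4 * Q ^ 2 + 1 * P ^ 1 * Q ^ 1 + 2 * P ^ 2 := by
  rcases lt_or_ge 0 (-1 * P - 1 * Q) with hv | hv
  · obtain ⟨v, hv'⟩ : ∃ v, v = (-1 * P - 1 * Q) := ⟨_, rfl⟩
    obtain ⟨w, hw'⟩ : ∃ w, w = (1 * P + 0 * Q) := ⟨_, rfl⟩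
    have h1 : 0 < v := by linarith
    have h2 : 0 ≤ w := by linarith
    have e1 : P = 0 * v + 1 * w := by rw [hv', hw']; ring
    have e2 : Q = -1 * v + -1 * w := by rw [hv', hw']; ring
    have e3 : 4 * Q ^ 2 + 1 * P ^ 1 * Q ^ 1 + 2 * P ^ 2 = 4 * v ^ 2 + 7 * w ^ 1 * v ^ 1 + 5 * w ^ 2 := by rw [e1, e2]; ring
    rw [e3]; positivity
  obtain ⟨v, hv'⟩ : ∃ v, v = (0 * P - 1 * Q) := ⟨_, rfl⟩
  obtain ⟨w, hw'⟩ : ∃ w, w = (1 * P + 1 * Q) := ⟨_, rfl⟩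
  have h1 : 0 < v := by linarith
  have h2 : 0 ≤ w := by linarith
  have e1 : P = 1 * v + 1 * w := by rw [hv', hw']; ring
  have e2 : Q = -1 * v + 0 * w := by rw [hv', hw']; ring
  have e3 : 4 * Q ^ 2 + 1 * P ^ 1 * Q ^ 1 + 2 * P ^ 2 = 5 * v ^ 2 + 3 * w ^ 1 * v ^ 1 + 2 * w ^ 2 := by rw [e1, e2]; ring
  rw [e3]; positivity
lemma posP7 (P Q : ℤ) (hQ : 0 < Q) (h : 13 * Q < 10 * P) : 0 < 4 * Q ^ 2 + 1 * P ^ 1 * Q ^ 1 + 2 * P ^ 2 := by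
  obtain ⟨w, hw'⟩ : ∃ w, w = 10 * P - 13 * Q := ⟨_, rfl⟩
  have h2 : 0 < w := by linarith
  have e3 : 100 * (4 * Q ^ 2 + 1 * P ^ 1 * Q ^ 1 + 2 * P ^ 2) = 868 * Q ^ 2 + 62 * w ^ 1 * Q ^ 1 + 2 * w ^ 2 := by rw [hw']; ring
  have e4 : 0 < 868 * Q ^ 2 + 62 * w ^ 1 * Q ^ 1 + 2 * w ^ 2 := by positivity
  linarith

lemma posN8 (P Q : ℤ) (hP : 0 < P) (hQ : Q < 0) : 0 < - 1 * Q ^ 1 + 2 * P ^ 1 := by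
  obtain ⟨v, hv'⟩ : ∃ v, v = (0 * P - 1 * Q) := ⟨_, rfl⟩
  obtain ⟨w, hw'⟩ : ∃ w, w = (1 * P + 0 * Q) := ⟨_, rfl⟩
  have h1 : 0 < v := by linarith
  have h2 : 0 ≤ w := by linarith
  have e1 : P = 0 * v + 1 * w := by rw [hv', hw']; ring
  have e2 : Q = -1 * v + 0 * w := by rw [hv', hw']; ring
  have e3 : - 1 * Q ^ 1 + 2 * P ^ 1 = 1 * v ^ 1 + 2 * w ^ 1 := by rw [e1, e2]; ring
  rw [e3]; positivity
lemma posP8 (P Q : ℤ) (hQ : 0 < Q) (h : 13 * Q < 10 * P) : 0 < - 1 * Q ^ 1 + 2 * P ^ 1 := by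
  obtain ⟨w, hw'⟩ : ∃ w, w = 10 * P - 13 * Q := ⟨_, rfl⟩
  have h2 : 0 < w := by linarith
  have e3 : 10 * (- 1 * Q ^ 1 + 2 * P ^ 1) = 16 * Q ^ 1 + 2 * w ^ 1 := by rw [hw']; ring
  have e4 : 0 < 16 * Q ^ 1 + 2 * w ^ 1 := by positivity
  linarith

/-- Passing between congruences of integers and equalities in `ZMod n`. -/
lemma zres {a r : ℤ} (n : ℕ) (h : (a : ZMod n) = (r : ZMod n)) : a % (n : ℤ) = r % (n : ℤ) :=
  (ZMod.intCast_eq_intCast_iff' a r n).1 h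

lemma zcast24 {a r : ℤ} (h : a % 24 = r) : (a : ZMod 24) = (r : ZMod 24) := by
  rw [ZMod.intCast_eq_intCast_iff' a r 24]; push_cast; omega

lemma zres24 {a r : ℤ} (hr : r % 24 = r) (h : (a : ZMod 24) = (r : ZMod 24)) : a % 24 = r := by
  rw [← hr]; exact zres 24 h

lemma zres7 {a r : ℤ} (hr : r % 7 = r) (h : (a : ZMod 7) = (r : ZMod 7)) : a % 7 = r := by
  rw [← hr]; exact zres 7 h

lemma cpc {p Q c : ℤ} (m : ℤ) (d : ℕ) (h : IsCoprime p m) (hc : c ∣ m) (cpQ : IsCoprime p Q) :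
    IsCoprime p (c * Q ^ d) :=
  (IsCoprime.of_isCoprime_of_dvd_right h hc).mul_right cpQ.pow_right


/-- Residues modulo twenty-four of the forms occurring in the chains, as functions of `Q`. -/
lemma rt0 {p Q : ℤ} (hp : p % 24 = 1 ∨ p % 24 = 9 ∨ p % 24 = 17) :
    (Q % 24 = 5 → Res (2 * Q ^ 10 - 4374 * p ^ 4 * Q ^ 6 - 19683 * p ^ 5 * Q ^ 5 - 177147 * p ^ 6 * Q ^ 4 + 387420489 * p ^ 10) 11) ∧
    (Q % 24 = 11 → Res (2 * Q ^ 10 - 4374 * p ^ 4 * Q ^ 6 - 19683 * p ^ 5 * Q ^ 5 - 177147 * p ^ 6 * Q ^ 4 + 387420489 * p ^ 10) 17) ∧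
    (Q % 24 = 17 → Res (2 * Q ^ 10 - 4374 * p ^ 4 * Q ^ 6 - 19683 * p ^ 5 * Q ^ 5 - 177147 * p ^ 6 * Q ^ 4 + 387420489 * p ^ 10) 23) ∧
    (Q % 24 = 23 → Res (2 * Q ^ 10 - 4374 * p ^ 4 * Q ^ 6 - 19683 * p ^ 5 * Q ^ 5 - 177147 * p ^ 6 * Q ^ 4 + 387420489 * p ^ 10) 5) := by
  refine ⟨fun hQ => ⟨?_, by norm_num, by norm_num⟩, fun hQ => ⟨?_, by norm_num, by norm_num⟩,
    fun hQ => ⟨?_, by norm_num, by norm_num⟩, fun hQ => ⟨?_, by norm_num, by norm_num⟩⟩ <;>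
  (have hQ' := zcast24 hQ
   push_cast at hQ'
   rcases hp with hp | hp | hp <;>
   (have hp' := zcast24 hp
    push_cast at hp'
    refine zres24 (by norm_num) ?_
    push_cast
    rw [hp', hQ']
    decide +kernel))

lemma rt1 {p Q : ℤ} (hp : p % 24 = 1 ∨ p % 24 = 9 ∨ p % 24 = 17) :
    (Q % 24 = 5 → Res (- 2 * Q ^ 9 - 12 * p ^ 1 * Q ^ 8 - 54 * p ^ 2 * Q ^ 7 - 486 * p ^ 3 * Q ^ 6 + 19683 * p ^ 5 * Q ^ 4 + 177147 * p ^ 6 * Q ^ 3 + 1062882 * p ^ 7 * Q ^ 2 + 9565938 * p ^ 8 * Q ^ 1 + 43046721 * p ^ 9) 5) ∧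
    (Q % 24 = 11 → Res (- 2 * Q ^ 9 - 12 * p ^ 1 * Q ^ 8 - 54 * p ^ 2 * Q ^ 7 - 486 * p ^ 3 * Q ^ 6 + 19683 * p ^ 5 * Q ^ 4 + 177147 * p ^ 6 * Q ^ 3 + 1062882 * p ^ 7 * Q ^ 2 + 9565938 * p ^ 8 * Q ^ 1 + 43046721 * p ^ 9) 11) ∧
    (Q % 24 = 17 → Res (- 2 * Q ^ 9 - 12 * p ^ 1 * Q ^ 8 - 54 * p ^ 2 * Q ^ 7 - 486 * p ^ 3 * Q ^ 6 + 19683 * p ^ 5 * Q ^ 4 + 177147 * p ^ 6 * Q ^ 3 + 1062882 * p ^ 7 * Q ^ 2 + 9565938 * p ^ 8 * Q ^ 1 + 43046721 * p ^ 9) 17) ∧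
    (Q % 24 = 23 → Res (- 2 * Q ^ 9 - 12 * p ^ 1 * Q ^ 8 - 54 * p ^ 2 * Q ^ 7 - 486 * p ^ 3 * Q ^ 6 + 19683 * p ^ 5 * Q ^ 4 + 177147 * p ^ 6 * Q ^ 3 + 1062882 * p ^ 7 * Q ^ 2 + 9565938 * p ^ 8 * Q ^ 1 + 43046721 * p ^ 9) 23) := by
  refine ⟨fun hQ => ⟨?_, by norm_num, by norm_num⟩, fun hQ => ⟨?_, by norm_num, by norm_num⟩,
    fun hQ => ⟨?_, by norm_num, by norm_num⟩, fun hQ => ⟨?_, by norm_num, by norm_num⟩⟩ <;>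
  (have hQ' := zcast24 hQ
   push_cast at hQ'
   rcases hp with hp | hp | hp <;>
   (have hp' := zcast24 hp
    push_cast at hp'
    refine zres24 (by norm_num) ?_
    push_cast
    rw [hp', hQ']
    decide +kernel))

lemma rt2 {p Q : ℤ} (hp : p % 24 = 1 ∨ p % 24 = 9 ∨ p % 24 = 17) :
    (Q % 24 = 5 → Res (- 2 * Q ^ 8 - 18 * p ^ 1 * Q ^ 7 + 59049 * p ^ 5 * Q ^ 3 + 177147 * p ^ 6 * Q ^ 2 + 14348907 * p ^ 8) 7) ∧
    (Q % 24 = 11 → Res (- 2 * Q ^ 8 - 18 * p ^ 1 * Q ^ 7 + 59049 * p ^ 5 * Q ^ 3 + 177147 * p ^ 6 * Q ^ 2 + 14348907 * p ^ 8) 1) ∧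
    (Q % 24 = 17 → Res (- 2 * Q ^ 8 - 18 * p ^ 1 * Q ^ 7 + 59049 * p ^ 5 * Q ^ 3 + 177147 * p ^ 6 * Q ^ 2 + 14348907 * p ^ 8) 19) ∧
    (Q % 24 = 23 → Res (- 2 * Q ^ 8 - 18 * p ^ 1 * Q ^ 7 + 59049 * p ^ 5 * Q ^ 3 + 177147 * p ^ 6 * Q ^ 2 + 14348907 * p ^ 8) 13) := by
  refine ⟨fun hQ => ⟨?_, by norm_num, by norm_num⟩, fun hQ => ⟨?_, by norm_num, by norm_num⟩,
    fun hQ => ⟨?_, by norm_num, by norm_num⟩, fun hQ => ⟨?_, by norm_num, by norm_num⟩⟩ <;>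
  (have hQ' := zcast24 hQ
   push_cast at hQ'
   rcases hp with hp | hp | hp <;>
   (have hp' := zcast24 hp
    push_cast at hp'
    refine zres24 (by norm_num) ?_
    push_cast
    rw [hp', hQ']
    decide +kernel))

lemma rt3 {p Q : ℤ} (hp : p % 24 = 1 ∨ p % 24 = 9 ∨ p % 24 = 17) :
    (Q % 24 = 5 → Res (- 4 * Q ^ 7 + 162 * p ^ 2 * Q ^ 5 + 13122 * p ^ 4 * Q ^ 3 + 59049 * p ^ 5 * Q ^ 2 - 177147 * p ^ 6 * Q ^ 1 + 1594323 * p ^ 7) 13) ∧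
    (Q % 24 = 11 → Res (- 4 * Q ^ 7 + 162 * p ^ 2 * Q ^ 5 + 13122 * p ^ 4 * Q ^ 3 + 59049 * p ^ 5 * Q ^ 2 - 177147 * p ^ 6 * Q ^ 1 + 1594323 * p ^ 7) 19) ∧
    (Q % 24 = 17 → Res (- 4 * Q ^ 7 + 162 * p ^ 2 * Q ^ 5 + 13122 * p ^ 4 * Q ^ 3 + 59049 * p ^ 5 * Q ^ 2 - 177147 * p ^ 6 * Q ^ 1 + 1594323 * p ^ 7) 1) ∧
    (Q % 24 = 23 → Res (- 4 * Q ^ 7 + 162 * p ^ 2 * Q ^ 5 + 13122 * p ^ 4 * Q ^ 3 + 59049 * p ^ 5 * Q ^ 2 - 177147 * p ^ 6 * Q ^ 1 + 1594323 * p ^ 7) 7) := by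
  refine ⟨fun hQ => ⟨?_, by norm_num, by norm_num⟩, fun hQ => ⟨?_, by norm_num, by norm_num⟩,
    fun hQ => ⟨?_, by norm_num, by norm_num⟩, fun hQ => ⟨?_, by norm_num, by norm_num⟩⟩ <;>
  (have hQ' := zcast24 hQ
   push_cast at hQ'
   rcases hp with hp | hp | hp <;>
   (have hp' := zcast24 hp
    push_cast at hp'
    refine zres24 (by norm_num) ?_
    push_cast
    rw [hp', hQ']
    decide +kernel))

lemma rt4 {p Q : ℤ} (hp : p % 24 = 1 ∨ p % 24 = 9 ∨ p % 24 = 17) :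
    (Q % 24 = 5 → Res (4 * Q ^ 6 + 54 * p ^ 1 * Q ^ 5 + 162 * p ^ 2 * Q ^ 4 + 1458 * p ^ 3 * Q ^ 3 + 6561 * p ^ 4 * Q ^ 2 - 59049 * p ^ 5 * Q ^ 1 + 177147 * p ^ 6) 13) ∧
    (Q % 24 = 11 → Res (4 * Q ^ 6 + 54 * p ^ 1 * Q ^ 5 + 162 * p ^ 2 * Q ^ 4 + 1458 * p ^ 3 * Q ^ 3 + 6561 * p ^ 4 * Q ^ 2 - 59049 * p ^ 5 * Q ^ 1 + 177147 * p ^ 6) 7) ∧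
    (Q % 24 = 17 → Res (4 * Q ^ 6 + 54 * p ^ 1 * Q ^ 5 + 162 * p ^ 2 * Q ^ 4 + 1458 * p ^ 3 * Q ^ 3 + 6561 * p ^ 4 * Q ^ 2 - 59049 * p ^ 5 * Q ^ 1 + 177147 * p ^ 6) 1) ∧
    (Q % 24 = 23 → Res (4 * Q ^ 6 + 54 * p ^ 1 * Q ^ 5 + 162 * p ^ 2 * Q ^ 4 + 1458 * p ^ 3 * Q ^ 3 + 6561 * p ^ 4 * Q ^ 2 - 59049 * p ^ 5 * Q ^ 1 + 177147 * p ^ 6) 19) := by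
  refine ⟨fun hQ => ⟨?_, by norm_num, by norm_num⟩, fun hQ => ⟨?_, by norm_num, by norm_num⟩,
    fun hQ => ⟨?_, by norm_num, by norm_num⟩, fun hQ => ⟨?_, by norm_num, by norm_num⟩⟩ <;>
  (have hQ' := zcast24 hQ
   push_cast at hQ'
   rcases hp with hp | hp | hp <;>
   (have hp' := zcast24 hp
    push_cast at hp'
    refine zres24 (by norm_num) ?_
    push_cast
    rw [hp', hQ']
    decide +kernel))

lemma rt5 {p Q : ℤ} (hp : p % 24 = 1 ∨ p % 24 = 9 ∨ p % 24 = 17) :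
    (Q % 24 = 5 → Res (4 * Q ^ 4 + 72 * p ^ 1 * Q ^ 3 + 486 * p ^ 2 * Q ^ 2 + 3159 * p ^ 3 * Q ^ 1 + 17496 * p ^ 4) 13) ∧
    (Q % 24 = 11 → Res (4 * Q ^ 4 + 72 * p ^ 1 * Q ^ 3 + 486 * p ^ 2 * Q ^ 2 + 3159 * p ^ 3 * Q ^ 1 + 17496 * p ^ 4) 7) ∧
    (Q % 24 = 17 → Res (4 * Q ^ 4 + 72 * p ^ 1 * Q ^ 3 + 486 * p ^ 2 * Q ^ 2 + 3159 * p ^ 3 * Q ^ 1 + 17496 * p ^ 4) 1) ∧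
    (Q % 24 = 23 → Res (4 * Q ^ 4 + 72 * p ^ 1 * Q ^ 3 + 486 * p ^ 2 * Q ^ 2 + 3159 * p ^ 3 * Q ^ 1 + 17496 * p ^ 4) 19) := by
  refine ⟨fun hQ => ⟨?_, by norm_num, by norm_num⟩, fun hQ => ⟨?_, by norm_num, by norm_num⟩,
    fun hQ => ⟨?_, by norm_num, by norm_num⟩, fun hQ => ⟨?_, by norm_num, by norm_num⟩⟩ <;>
  (have hQ' := zcast24 hQ
   push_cast at hQ'
   rcases hp with hp | hp | hp <;>
   (have hp' := zcast24 hp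
    push_cast at hp'
    refine zres24 (by norm_num) ?_
    push_cast
    rw [hp', hQ']
    decide +kernel))

lemma rt6 {p Q : ℤ} (hp : p % 24 = 1 ∨ p % 24 = 9 ∨ p % 24 = 17) :
    (Q % 24 = 5 → Res (4 * Q ^ 3 + 27 * p ^ 1 * Q ^ 2 + 162 * p ^ 2 * Q ^ 1 + 1458 * p ^ 3) 11) ∧
    (Q % 24 = 11 → Res (4 * Q ^ 3 + 27 * p ^ 1 * Q ^ 2 + 162 * p ^ 2 * Q ^ 1 + 1458 * p ^ 3) 23) ∧
    (Q % 24 = 17 → Res (4 * Q ^ 3 + 27 * p ^ 1 * Q ^ 2 + 162 * p ^ 2 * Q ^ 1 + 1458 * p ^ 3) 11) ∧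
    (Q % 24 = 23 → Res (4 * Q ^ 3 + 27 * p ^ 1 * Q ^ 2 + 162 * p ^ 2 * Q ^ 1 + 1458 * p ^ 3) 23) := by
  refine ⟨fun hQ => ⟨?_, by norm_num, by norm_num⟩, fun hQ => ⟨?_, by norm_num, by norm_num⟩,
    fun hQ => ⟨?_, by norm_num, by norm_num⟩, fun hQ => ⟨?_, by norm_num, by norm_num⟩⟩ <;>
  (have hQ' := zcast24 hQ
   push_cast at hQ'
   rcases hp with hp | hp | hp <;>
   (have hp' := zcast24 hp
    push_cast at hp'
    refine zres24 (by norm_num) ?_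
    push_cast
    rw [hp', hQ']
    decide +kernel))

lemma rt7 {p Q : ℤ} (hp : p % 24 = 1 ∨ p % 24 = 9 ∨ p % 24 = 17) :
    (Q % 24 = 5 → Res (4 * Q ^ 2 + 9 * p ^ 1 * Q ^ 1 + 162 * p ^ 2) 19) ∧
    (Q % 24 = 11 → Res (4 * Q ^ 2 + 9 * p ^ 1 * Q ^ 1 + 162 * p ^ 2) 1) ∧
    (Q % 24 = 17 → Res (4 * Q ^ 2 + 9 * p ^ 1 * Q ^ 1 + 162 * p ^ 2) 7) ∧
    (Q % 24 = 23 → Res (4 * Q ^ 2 + 9 * p ^ 1 * Q ^ 1 + 162 * p ^ 2) 13) := by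
  refine ⟨fun hQ => ⟨?_, by norm_num, by norm_num⟩, fun hQ => ⟨?_, by norm_num, by norm_num⟩,
    fun hQ => ⟨?_, by norm_num, by norm_num⟩, fun hQ => ⟨?_, by norm_num, by norm_num⟩⟩ <;>
  (have hQ' := zcast24 hQ
   push_cast at hQ'
   rcases hp with hp | hp | hp <;>
   (have hp' := zcast24 hp
    push_cast at hp'
    refine zres24 (by norm_num) ?_
    push_cast
    rw [hp', hQ']
    decide +kernel))

lemma rt8 {p Q : ℤ} (hp : p % 24 = 1 ∨ p % 24 = 9 ∨ p % 24 = 17) :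
    (Q % 24 = 5 → Res (- 1 * Q ^ 1 + 18 * p ^ 1) 13) ∧
    (Q % 24 = 11 → Res (- 1 * Q ^ 1 + 18 * p ^ 1) 7) ∧
    (Q % 24 = 17 → Res (- 1 * Q ^ 1 + 18 * p ^ 1) 1) ∧
    (Q % 24 = 23 → Res (- 1 * Q ^ 1 + 18 * p ^ 1) 19) := by
  refine ⟨fun hQ => ⟨?_, by norm_num, by norm_num⟩, fun hQ => ⟨?_, by norm_num, by norm_num⟩,
    fun hQ => ⟨?_, by norm_num, by norm_num⟩, fun hQ => ⟨?_, by norm_num, by norm_num⟩⟩ <;>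
  (have hQ' := zcast24 hQ
   push_cast at hQ'
   rcases hp with hp | hp | hp <;>
   (have hp' := zcast24 hp
    push_cast at hp'
    refine zres24 (by norm_num) ?_
    push_cast
    rw [hp', hQ']
    decide +kernel))

lemma rG {p Q : ℤ} (hp : p % 24 = 1 ∨ p % 24 = 9 ∨ p % 24 = 17) :
    (Q % 24 = 5 → Res (2 * Q ^ 10 + 39366 * p ^ 5 * Q ^ 5 + 387420489 * p ^ 10) 17) ∧
    (Q % 24 = 11 → Res (2 * Q ^ 10 + 39366 * p ^ 5 * Q ^ 5 + 387420489 * p ^ 10) 5) ∧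
    (Q % 24 = 17 → Res (2 * Q ^ 10 + 39366 * p ^ 5 * Q ^ 5 + 387420489 * p ^ 10) 17) ∧
    (Q % 24 = 23 → Res (2 * Q ^ 10 + 39366 * p ^ 5 * Q ^ 5 + 387420489 * p ^ 10) 5) := by
  refine ⟨fun hQ => ⟨?_, by norm_num, by norm_num⟩, fun hQ => ⟨?_, by norm_num, by norm_num⟩,
    fun hQ => ⟨?_, by norm_num, by norm_num⟩, fun hQ => ⟨?_, by norm_num, by norm_num⟩⟩ <;>
  (have hQ' := zcast24 hQ
   push_cast at hQ'
   rcases hp with hp | hp | hp <;>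
   (have hp' := zcast24 hp
    push_cast at hp'
    refine zres24 (by norm_num) ?_
    push_cast
    rw [hp', hQ']
    decide +kernel))

lemma rV {p Q : ℤ} (hp : p % 24 = 1 ∨ p % 24 = 9 ∨ p % 24 = 17) :
    (Q % 24 = 5 → Res (2 * Q ^ 1 + 9 * p ^ 1) 19) ∧
    (Q % 24 = 11 → Res (2 * Q ^ 1 + 9 * p ^ 1) 7) ∧
    (Q % 24 = 17 → Res (2 * Q ^ 1 + 9 * p ^ 1) 19) ∧
    (Q % 24 = 23 → Res (2 * Q ^ 1 + 9 * p ^ 1) 7) := by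
  refine ⟨fun hQ => ⟨?_, by norm_num, by norm_num⟩, fun hQ => ⟨?_, by norm_num, by norm_num⟩,
    fun hQ => ⟨?_, by norm_num, by norm_num⟩, fun hQ => ⟨?_, by norm_num, by norm_num⟩⟩ <;>
  (have hQ' := zcast24 hQ
   push_cast at hQ'
   rcases hp with hp | hp | hp <;>
   (have hp' := zcast24 hp
    push_cast at hp'
    refine zres24 (by norm_num) ?_
    push_cast
    rw [hp', hQ']
    decide +kernel))

/-- Outcome of the first chain when five does not divide `18 p - Q`. -/
lemma caseB {x p Q z : ℤ} (hp : p = x ^ 2)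
    (hp24 : p % 24 = 1 ∨ p % 24 = 9 ∨ p % 24 = 17)
    (hQ24 : Q % 24 = 5 ∨ Q % 24 = 11 ∨ Q % 24 = 17 ∨ Q % 24 = 23)
    (cpQ : IsCoprime p Q) (hf : 3 ^ 31 * p ^ 17 - 4 * Q ^ 17 = 7 * z ^ 2)
    (hpos : 0 < p) (hreg : Q < 0 ∨ (0 < Q ∧ 13 * Q < 10 * (9 * p)))
    (h7 : Q % 7 ≠ 0) (h5 : (18 * p - Q) % 5 ≠ 0) : KJ 5 (18 * p - Q) = 1 := by
  obtain ⟨s0, hs0⟩ : ∃ s, s = 2 * Q ^ 10 - 4374 * p ^ 4 * Q ^ 6 - 19683 * p ^ 5 * Q ^ 5 - 177147 * p ^ 6 * Q ^ 4 + 387420489 * p ^ 10 := ⟨_, rfl⟩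
  obtain ⟨s1, hs1⟩ : ∃ s, s = - 2 * Q ^ 9 - 12 * p ^ 1 * Q ^ 8 - 54 * p ^ 2 * Q ^ 7 - 486 * p ^ 3 * Q ^ 6 + 19683 * p ^ 5 * Q ^ 4 + 177147 * p ^ 6 * Q ^ 3 + 1062882 * p ^ 7 * Q ^ 2 + 9565938 * p ^ 8 * Q ^ 1 + 43046721 * p ^ 9 := ⟨_, rfl⟩
  obtain ⟨s2, hs2⟩ : ∃ s, s = - 2 * Q ^ 8 - 18 * p ^ 1 * Q ^ 7 + 59049 * p ^ 5 * Q ^ 3 + 177147 * p ^ 6 * Q ^ 2 + 14348907 * p ^ 8 := ⟨_, rfl⟩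
  obtain ⟨s3, hs3⟩ : ∃ s, s = - 4 * Q ^ 7 + 162 * p ^ 2 * Q ^ 5 + 13122 * p ^ 4 * Q ^ 3 + 59049 * p ^ 5 * Q ^ 2 - 177147 * p ^ 6 * Q ^ 1 + 1594323 * p ^ 7 := ⟨_, rfl⟩
  obtain ⟨s4, hs4⟩ : ∃ s, s = 4 * Q ^ 6 + 54 * p ^ 1 * Q ^ 5 + 162 * p ^ 2 * Q ^ 4 + 1458 * p ^ 3 * Q ^ 3 + 6561 * p ^ 4 * Q ^ 2 - 59049 * p ^ 5 * Q ^ 1 + 177147 * p ^ 6 := ⟨_, rfl⟩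
  obtain ⟨s5, hs5⟩ : ∃ s, s = 4 * Q ^ 4 + 72 * p ^ 1 * Q ^ 3 + 486 * p ^ 2 * Q ^ 2 + 3159 * p ^ 3 * Q ^ 1 + 17496 * p ^ 4 := ⟨_, rfl⟩
  obtain ⟨s6, hs6⟩ : ∃ s, s = 4 * Q ^ 3 + 27 * p ^ 1 * Q ^ 2 + 162 * p ^ 2 * Q ^ 1 + 1458 * p ^ 3 := ⟨_, rfl⟩
  obtain ⟨s7, hs7⟩ : ∃ s, s = 4 * Q ^ 2 + 9 * p ^ 1 * Q ^ 1 + 162 * p ^ 2 := ⟨_, rfl⟩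
  obtain ⟨s8, hs8⟩ : ∃ s, s = - 1 * Q ^ 1 + 18 * p ^ 1 := ⟨_, rfl⟩
  have p4 : IsCoprime p 4 := by
    have h : IsCoprime 2 p := cop2 (by omega)
    have := (h.pow_left (m := 2)).symm
    norm_num at this; exact this
  have Q6 : IsCoprime Q (6 ^ 20) := by
    have h : IsCoprime 2 Q := cop2 (by omega)
    have h' : IsCoprime 3 Q := cop3 (by omega)
    have := (h.mul_left h').symm.pow_right (n := 20)
    norm_num at this ⊢; exact this
  have cp0 : IsCoprime p s0 := cop_of_eq (q := - 4374 * p ^ 3 * Q ^ 6 - 19683 * p ^ 4 * Q ^ 5 - 177147 * p ^ 5 * Q ^ 4 + 387420489 * p ^ 9)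
    (c := (2) * Q ^ 10) (by rw [hs0]; ring) (cpc 4 10 p4 (by norm_num) cpQ)
  have cp1 : IsCoprime p s1 := cop_of_eq (q := - 12 * Q ^ 8 - 54 * p ^ 1 * Q ^ 7 - 486 * p ^ 2 * Q ^ 6 + 19683 * p ^ 4 * Q ^ 4 + 177147 * p ^ 5 * Q ^ 3 + 1062882 * p ^ 6 * Q ^ 2 + 9565938 * p ^ 7 * Q ^ 1 + 43046721 * p ^ 8)
    (c := (-2) * Q ^ 9) (by rw [hs1]; ring) (cpc 4 9 p4 (by norm_num) cpQ)
  have cp2 : IsCoprime p s2 := cop_of_eq (q := - 18 * Q ^ 7 + 59049 * p ^ 4 * Q ^ 3 + 177147 * p ^ 5 * Q ^ 2 + 14348907 * p ^ 7)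
    (c := (-2) * Q ^ 8) (by rw [hs2]; ring) (cpc 4 8 p4 (by norm_num) cpQ)
  have cp3 : IsCoprime p s3 := cop_of_eq (q := 162 * p ^ 1 * Q ^ 5 + 13122 * p ^ 3 * Q ^ 3 + 59049 * p ^ 4 * Q ^ 2 - 177147 * p ^ 5 * Q ^ 1 + 1594323 * p ^ 6)
    (c := (-4) * Q ^ 7) (by rw [hs3]; ring) (cpc 4 7 p4 (by norm_num) cpQ)
  have cp4 : IsCoprime p s4 := cop_of_eq (q := 54 * Q ^ 5 + 162 * p ^ 1 * Q ^ 4 + 1458 * p ^ 2 * Q ^ 3 + 6561 * p ^ 3 * Q ^ 2 - 59049 * p ^ 4 * Q ^ 1 + 177147 * p ^ 5)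
    (c := (4) * Q ^ 6) (by rw [hs4]; ring) (cpc 4 6 p4 (by norm_num) cpQ)
  have cp5 : IsCoprime p s5 := cop_of_eq (q := 72 * Q ^ 3 + 486 * p ^ 1 * Q ^ 2 + 3159 * p ^ 2 * Q ^ 1 + 17496 * p ^ 3)
    (c := (4) * Q ^ 4) (by rw [hs5]; ring) (cpc 4 4 p4 (by norm_num) cpQ)
  have cp7 : IsCoprime p s7 := cop_of_eq (q := 9 * Q ^ 1 + 162 * p ^ 1)
    (c := (4) * Q ^ 2) (by rw [hs7]; ring) (cpc 4 2 p4 (by norm_num) cpQ)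
  have iQ0 : s0 = (2 * Q ^ 9 - 4374 * p ^ 4 * Q ^ 5 - 19683 * p ^ 5 * Q ^ 4 - 177147 * p ^ 6 * Q ^ 3) * Q + 387420489 * p ^ 10 := by rw [hs0]; ring
  have cQ0 : IsCoprime Q s0 := cop_of_eq iQ0 (cpc (6 ^ 20) 10 Q6 (by norm_num) cpQ.symm)
  have iQ1 : s1 = (- 2 * Q ^ 8 - 12 * p ^ 1 * Q ^ 7 - 54 * p ^ 2 * Q ^ 6 - 486 * p ^ 3 * Q ^ 5 + 19683 * p ^ 5 * Q ^ 3 + 177147 * p ^ 6 * Q ^ 2 + 1062882 * p ^ 7 * Q ^ 1 + 9565938 * p ^ 8) * Q + 43046721 * p ^ 9 := by rw [hs1]; ring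
  have cQ1 : IsCoprime Q s1 := cop_of_eq iQ1 (cpc (6 ^ 20) 9 Q6 (by norm_num) cpQ.symm)
  have iQ2 : s2 = (- 2 * Q ^ 7 - 18 * p ^ 1 * Q ^ 6 + 59049 * p ^ 5 * Q ^ 2 + 177147 * p ^ 6 * Q ^ 1) * Q + 14348907 * p ^ 8 := by rw [hs2]; ring
  have cQ2 : IsCoprime Q s2 := cop_of_eq iQ2 (cpc (6 ^ 20) 8 Q6 (by norm_num) cpQ.symm)
  have iQ3 : s3 = (- 4 * Q ^ 6 + 162 * p ^ 2 * Q ^ 4 + 13122 * p ^ 4 * Q ^ 2 + 59049 * p ^ 5 * Q ^ 1 - 177147 * p ^ 6) * Q + 1594323 * p ^ 7 := by rw [hs3]; ring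
  have cQ3 : IsCoprime Q s3 := cop_of_eq iQ3 (cpc (6 ^ 20) 7 Q6 (by norm_num) cpQ.symm)
  have iQ4 : s4 = (4 * Q ^ 5 + 54 * p ^ 1 * Q ^ 4 + 162 * p ^ 2 * Q ^ 3 + 1458 * p ^ 3 * Q ^ 2 + 6561 * p ^ 4 * Q ^ 1 - 59049 * p ^ 5) * Q + 177147 * p ^ 6 := by rw [hs4]; ring
  have cQ4 : IsCoprime Q s4 := cop_of_eq iQ4 (cpc (6 ^ 20) 6 Q6 (by norm_num) cpQ.symm)
  have iQ6 : s6 = (4 * Q ^ 2 + 27 * p ^ 1 * Q ^ 1 + 162 * p ^ 2) * Q + 1458 * p ^ 3 := by rw [hs6]; ring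
  have cQ6 : IsCoprime Q s6 := cop_of_eq iQ6 (cpc (6 ^ 20) 3 Q6 (by norm_num) cpQ.symm)
  have iQ8 : s8 = (- 1) * Q + 18 * p ^ 1 := by rw [hs8]; ring
  have cQ8 : IsCoprime Q s8 := cop_of_eq iQ8 (cpc (6 ^ 20) 1 Q6 (by norm_num) cpQ.symm)
  have kp : KJ p Q = 1 := KJ_p hp cpQ
  have k3Q : KJ 3 Q ^ 2 = 1 := KJ_sq (cop3 (by omega))
  have m0 : KJ s0 Q = 1 := by
    have e : (387420489 : ℤ) = 3 ^ 18 := by norm_num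
    have e' : KJ 3 Q ^ 18 = (KJ 3 Q ^ 2) ^ 9 := by ring
    rw [KJ_mod iQ0, KJ_mul, KJ_pow, kp, e, KJ_pow, e', k3Q]; ring
  have m1 : KJ s1 Q = 1 := by
    have e : (43046721 : ℤ) = 3 ^ 16 := by norm_num
    have e' : KJ 3 Q ^ 16 = (KJ 3 Q ^ 2) ^ 8 := by ring
    rw [KJ_mod iQ1, KJ_mul, KJ_pow, kp, e, KJ_pow, e', k3Q]; ring
  have m2 : KJ s2 Q = KJ 3 Q := by
    have e : (14348907 : ℤ) = 3 ^ 15 := by norm_num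
    have e' : KJ 3 Q ^ 15 = (KJ 3 Q ^ 2) ^ 7 * KJ 3 Q := by ring
    rw [KJ_mod iQ2, KJ_mul, KJ_pow, kp, e, KJ_pow, e', k3Q]; ring
  have m3 : KJ s3 Q = KJ 3 Q := by
    have e : (1594323 : ℤ) = 3 ^ 13 := by norm_num
    have e' : KJ 3 Q ^ 13 = (KJ 3 Q ^ 2) ^ 6 * KJ 3 Q := by ring
    rw [KJ_mod iQ3, KJ_mul, KJ_pow, kp, e, KJ_pow, e', k3Q]; ring
  have m4 : KJ s4 Q = KJ 3 Q := by
    have e : (177147 : ℤ) = 3 ^ 11 := by norm_num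
    have e' : KJ 3 Q ^ 11 = (KJ 3 Q ^ 2) ^ 5 * KJ 3 Q := by ring
    rw [KJ_mod iQ4, KJ_mul, KJ_pow, kp, e, KJ_pow, e', k3Q]; ring
  have hm7 : s0 % 7 = 3 ∨ s0 % 7 = 5 ∨ s0 % 7 = 6 := by
    have key : ∀ a b : ZMod 7, 3 ^ 31 * a ^ 17 - 4 * b ^ 17 = 0 → b ≠ 0 →
        2 * b ^ 10 - 4374 * a ^ 4 * b ^ 6 - 19683 * a ^ 5 * b ^ 5 - 177147 * a ^ 6 * b ^ 4 + 387420489 * a ^ 10 = 3 ∨ 2 * b ^ 10 - 4374 * a ^ 4 * b ^ 6 - 19683 * a ^ 5 * b ^ 5 - 177147 * a ^ 6 * b ^ 4 + 387420489 * a ^ 10 = 5 ∨ 2 * b ^ 10 - 4374 * a ^ 4 * b ^ 6 - 19683 * a ^ 5 * b ^ 5 - 177147 * a ^ 6 * b ^ 4 + 387420489 * a ^ 10 = 6 := by decide +kernel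
    have h1 : (3 : ZMod 7) ^ 31 * (p : ZMod 7) ^ 17 - 4 * (Q : ZMod 7) ^ 17 = 0 := by
      have := congrArg (Int.cast : ℤ → ZMod 7) hf
      push_cast at this
      have e : (3 : ZMod 7) ^ 31 = 617673396283947 := by decide +kernel
      rw [e, this]
      have : (7 : ZMod 7) = 0 := by decide
      rw [this, zero_mul]
    have h2 : (Q : ZMod 7) ≠ 0 := by
      intro h; apply h7
      have := (ZMod.intCast_zmod_eq_zero_iff_dvd Q 7).1 h
      omega
    rcases key _ _ h1 h2 with h | h | h
    · left; rw [hs0]; exact zres7 (r := 3) (by norm_num) (by push_cast; exact h)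
    · right; left; rw [hs0]; exact zres7 (r := 5) (by norm_num) (by push_cast; exact h)
    · right; right; rw [hs0]; exact zres7 (r := 6) (by norm_num) (by push_cast; exact h)
  have m7 : KJ s0 7 = -1 := by
    rw [KJ_at_seven]; split_ifs <;> first | rfl | omega
  have c7 : IsCoprime 7 s0 := cop7 (by omega)
  have c5 : IsCoprime 5 s8 := cop5 (by
    have e : s8 = 18 * p - Q := by rw [hs8]; ring
    rw [e]; exact h5)
  have g0 : 0 < Q ∨ 0 < s0 := by
    rcases hreg with h | ⟨h, h'⟩
    · right; have := posN0 (9 * p) Q (by linarith) h; rw [hs0]; ring_nf at this ⊢; linarith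
    · exact Or.inl h
  have g1 : 0 < s1 := by
    rcases hreg with h | ⟨h, h'⟩
    · have := posN1 (9 * p) Q (by linarith) h; rw [hs1]; ring_nf at this ⊢; linarith
    · have := posP1 (9 * p) Q h h'; rw [hs1]; ring_nf at this ⊢; linarith
  have g2 : 0 < -Q ∨ 0 < s2 := by
    rcases hreg with h | ⟨h, h'⟩
    · left; linarith
    · right; have := posP2 (9 * p) Q h h'; rw [hs2]; ring_nf at this ⊢; linarith
  have g3 : 0 < s3 := by
    rcases hreg with h | ⟨h, h'⟩
    · have := posN3 (9 * p) Q (by linarith) h; rw [hs3]; ring_nf at this ⊢; linarith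
    · have := posP3 (9 * p) Q h h'; rw [hs3]; ring_nf at this ⊢; linarith
  have g4 : 0 < s4 := by
    rcases hreg with h | ⟨h, h'⟩
    · have := posN4 (9 * p) Q (by linarith) h; rw [hs4]; ring_nf at this ⊢; linarith
    · have := posP4 (9 * p) Q h h'; rw [hs4]; ring_nf at this ⊢; linarith
  have g5 : 0 < s5 := by
    rcases hreg with h | ⟨h, h'⟩
    · have := posN5 (9 * p) Q (by linarith) h; rw [hs5]; ring_nf at this ⊢; linarith
    · have := posP5 (9 * p) Q h h'; rw [hs5]; ring_nf at this ⊢; linarith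
  have g7 : 0 < s7 := by
    rcases hreg with h | ⟨h, h'⟩
    · have := posN7 (9 * p) Q (by linarith) h; rw [hs7]; ring_nf at this ⊢; linarith
    · have := posP7 (9 * p) Q h h'; rw [hs7]; ring_nf at this ⊢; linarith
  have g8 : 0 < s8 := by
    rcases hreg with h | ⟨h, h'⟩
    · have := posN8 (9 * p) Q (by linarith) h; rw [hs8]; ring_nf at this ⊢; linarith
    · have := posP8 (9 * p) Q h h'; rw [hs8]; ring_nf at this ⊢; linarith
  have i0 : 7 * z ^ 2 = (- 2 * Q ^ 7 + 729 * p ^ 3 * Q ^ 4 + 1594323 * p ^ 7) * s0 + (3 ^ 6 * p ^ 3 * Q ^ 5) * s1 := by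
    rw [← hf, hs0, hs1]; ring
  have i1 : 1 * s0 = (- 1 * Q ^ 1 + 9 * p ^ 1) * s1 + (-1 * 3 * p * Q) * s2 := by
    rw [hs0, hs1, hs2]; ring
  have i2 : 1 * s1 = (1 * Q ^ 1 + 3 * p ^ 1) * s2 + (3 * p * (-Q)) * s3 := by
    rw [hs1, hs2, hs3]; ring
  have i3 : (2 ^ 2 * Q) * s2 = (2 * Q ^ 2 + 18 * p ^ 1 * Q ^ 1 + 81 * p ^ 2) * s3 + (-1 * 3 ^ 6 * p ^ 3) * s4 := by
    rw [hs2, hs3, hs4]; ring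
  have i4 : (3 ^ 3 * p ^ 2) * s3 = (4 * Q ^ 3 + 18 * p ^ 1 * Q ^ 2 + 54 * p ^ 2 * Q ^ 1 + 243 * p ^ 3) * s4 + (-1 * 2 ^ 2 * Q ^ 5) * s5 := by
    rw [hs3, hs4, hs5]; ring
  have i5 : 2 * s4 = (2 * Q ^ 2 - 9 * p ^ 1 * Q ^ 1) * s5 + (3 ^ 5 * p ^ 3) * s6 := by
    rw [hs4, hs5, hs6]; ring
  have i6 : (2 * 3) * s5 = (5 * Q ^ 1 + 72 * p ^ 1) * s6 + Q ^ 2 * s7 := by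
    rw [hs5, hs6, hs7]; ring
  have i7 : 2 * s6 = (2 * Q ^ 1 + 9 * p ^ 1) * s7 + (3 ^ 4 * p ^ 2) * s8 := by
    rw [hs6, hs7, hs8]; ring
  have i8 : 1 * s7 = (1 * Q ^ 1 + 9 * p ^ 1) * s8 + Q ^ 2 * 5 := by
    rw [hs7, hs8]; ring
  have e8 : 18 * p - Q = s8 := by rw [hs8]; ring
  rw [e8]
  have R0 := rt0 (Q := Q) hp24
  have R1 := rt1 (Q := Q) hp24
  have R2 := rt2 (Q := Q) hp24
  have R3 := rt3 (Q := Q) hp24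
  have R4 := rt4 (Q := Q) hp24
  have R5 := rt5 (Q := Q) hp24
  have R6 := rt6 (Q := Q) hp24
  have R7 := rt7 (Q := Q) hp24
  have R8 := rt8 (Q := Q) hp24

  simp only [← hs0, ← hs1, ← hs2, ← hs3, ← hs4, ← hs5, ← hs6, ← hs7, ← hs8] at R0 R1 R2 R3 R4 R5 R6 R7 R8
  rcases hQ24 with h | h | h | h
  · rw [chainB hp i0 i1 i2 i3 i4 i5 i6 i7 i8
      (R0.1 h) (R1.1 h) (R2.1 h) (R3.1 h) (R4.1 h) (R5.1 h) (R6.1 h) (R7.1 h) (R8.1 h)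
      (rQ := 5) ⟨h, by norm_num, by norm_num⟩ cp0 cp1 cp2 cp3 cp4 cp5 cp7 cQ0 cQ1 cQ2 cQ3 cQ4 cQ6 cQ8 c5
      g0 g1 g2 g3 g4 g5 g7 m0 m1 m2 m3 m4 m7 c7]
    decide
  · rw [chainB hp i0 i1 i2 i3 i4 i5 i6 i7 i8
      (R0.2.1 h) (R1.2.1 h) (R2.2.1 h) (R3.2.1 h) (R4.2.1 h) (R5.2.1 h) (R6.2.1 h) (R7.2.1 h) (R8.2.1 h)
      (rQ := 11) ⟨h, by norm_num, by norm_num⟩ cp0 cp1 cp2 cp3 cp4 cp5 cp7 cQ0 cQ1 cQ2 cQ3 cQ4 cQ6 cQ8 c5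
      g0 g1 g2 g3 g4 g5 g7 m0 m1 m2 m3 m4 m7 c7]
    decide
  · rw [chainB hp i0 i1 i2 i3 i4 i5 i6 i7 i8
      (R0.2.2.1 h) (R1.2.2.1 h) (R2.2.2.1 h) (R3.2.2.1 h) (R4.2.2.1 h) (R5.2.2.1 h) (R6.2.2.1 h) (R7.2.2.1 h) (R8.2.2.1 h)
      (rQ := 17) ⟨h, by norm_num, by norm_num⟩ cp0 cp1 cp2 cp3 cp4 cp5 cp7 cQ0 cQ1 cQ2 cQ3 cQ4 cQ6 cQ8 c5
      g0 g1 g2 g3 g4 g5 g7 m0 m1 m2 m3 m4 m7 c7]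
    decide
  · rw [chainB hp i0 i1 i2 i3 i4 i5 i6 i7 i8
      (R0.2.2.2 h) (R1.2.2.2 h) (R2.2.2.2 h) (R3.2.2.2 h) (R4.2.2.2 h) (R5.2.2.2 h) (R6.2.2.2 h) (R7.2.2.2 h) (R8.2.2.2 h)
      (rQ := 23) ⟨h, by norm_num, by norm_num⟩ cp0 cp1 cp2 cp3 cp4 cp5 cp7 cQ0 cQ1 cQ2 cQ3 cQ4 cQ6 cQ8 c5
      g0 g1 g2 g3 g4 g5 g7 m0 m1 m2 m3 m4 m7 c7]
    decide

/-- Splitting off the two-part of the cubic form. -/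
lemma Tsplit {T : ℤ} (h : T % 24 = 8 ∨ T % 24 = 14 ∨ T % 24 = 20 ∨ T % 24 = 2) :
    ∃ (k : ℕ) (T2 : ℤ), T = 2 ^ k * T2 ∧
      (T2 % 24 = 1 ∨ T2 % 24 = 5 ∨ T2 % 24 = 7 ∨ T2 % 24 = 11 ∨ T2 % 24 = 13 ∨ T2 % 24 = 17 ∨
        T2 % 24 = 19 ∨ T2 % 24 = 23) ∧ (T % 24 = 14 → k = 1 ∧ T2 % 12 = 7) ∧
      (T % 24 = 20 → k = 2) ∧ (T % 24 = 2 → k = 1 ∧ T2 % 12 = 1) := by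
  have hT0 : T ≠ 0 := by omega
  have hfin : FiniteMultiplicity 2 T := Int.finiteMultiplicity_iff.2 ⟨by decide, hT0⟩
  obtain ⟨T2, hT, hn⟩ := hfin.exists_eq_pow_mul_and_not_dvd
  obtain ⟨k, hk⟩ : ∃ k, k = multiplicity 2 T := ⟨_, rfl⟩
  rw [← hk] at hT
  have h3 : ¬ (3 : ℤ) ∣ T2 := by
    intro h3
    have : (3 : ℤ) ∣ T := by rw [hT]; exact h3.mul_left _
    omega
  refine ⟨k, T2, hT, by omega, ?_⟩
  rcases k with _ | _ | _ | k
  · rw [pow_zero, one_mul] at hT; omega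
  · norm_num at hT; omega
  · norm_num at hT; omega
  · have : T = 8 * (2 ^ k * T2) := by rw [hT]; ring
    omega

lemma Tres {p Q : ℤ} (hp24 : p % 24 = 1 ∨ p % 24 = 9 ∨ p % 24 = 17) :
    (Q % 24 = 5 → (Q ^ 3 + 243 * p ^ 3) % 24 = 8) ∧
    (Q % 24 = 11 → (Q ^ 3 + 243 * p ^ 3) % 24 = 14) ∧
    (Q % 24 = 17 → (Q ^ 3 + 243 * p ^ 3) % 24 = 20) ∧
    (Q % 24 = 23 → (Q ^ 3 + 243 * p ^ 3) % 24 = 2) := by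
  refine ⟨fun hQ => ?_, fun hQ => ?_, fun hQ => ?_, fun hQ => ?_⟩ <;>
  (have hQ' := zcast24 hQ
   push_cast at hQ'
   rcases hp24 with hp | hp | hp <;>
   (have hp' := zcast24 hp
    push_cast at hp'
    refine zres24 (by norm_num) ?_
    push_cast
    rw [hp', hQ']
    decide +kernel))

lemma Gpos {p Q : ℤ} (hpos : 0 < p) :
    0 < 2 * Q ^ 10 + 39366 * p ^ 5 * Q ^ 5 + 387420489 * p ^ 10 := by
  have h1 : 0 < p ^ 5 := by positivity
  have e : 2 * (2 * Q ^ 10 + 39366 * p ^ 5 * Q ^ 5 + 387420489 * p ^ 10) =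
    (2 * Q ^ 5 + 19683 * p ^ 5) ^ 2 + 387420489 * (p ^ 5) ^ 2 := by ring
  have h2 : 0 < 387420489 * (p ^ 5) ^ 2 := by positivity
  have h3 := sq_nonneg (2 * Q ^ 5 + 19683 * p ^ 5)
  linarith

lemma TVsign {p Q : ℤ} (hpos : 0 < p) (hV : 0 ≤ 2 * Q + 9 * p) : 0 < Q ^ 3 + 243 * p ^ 3 := by
  have e2 : 16 * (Q ^ 3 + 243 * p ^ 3) = (2 * Q + 9 * p) * ((2 * Q - 9 * p) ^ 2
    + (2 * Q) ^ 2 + (9 * p) ^ 2) + 2430 * p ^ 3 := by ring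
  have h1 : 0 < p ^ 3 := by positivity
  have h2 : 0 ≤ (2 * Q + 9 * p) * ((2 * Q - 9 * p) ^ 2
    + (2 * Q) ^ 2 + (9 * p) ^ 2) := mul_nonneg hV (by positivity)
  linarith

lemma z7zero {p Q z : ℤ} (hf : 3 ^ 31 * p ^ 17 - 4 * Q ^ 17 = 7 * z ^ 2) :
    (3 : ZMod 7) ^ 31 * (p : ZMod 7) ^ 17 - 4 * (Q : ZMod 7) ^ 17 = 0 := by
  have := congrArg (Int.cast : ℤ → ZMod 7) hf
  push_cast at this
  have e : (3 : ZMod 7) ^ 31 = 617673396283947 := by decide +kernel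
  rw [e, this]
  have : (7 : ZMod 7) = 0 := by decide
  rw [this, zero_mul]

lemma G7 {p Q z : ℤ} (hf : 3 ^ 31 * p ^ 17 - 4 * Q ^ 17 = 7 * z ^ 2) (h7 : Q % 7 ≠ 0) {G : ℤ}
    (hG : G = 2 * Q ^ 10 + 39366 * p ^ 5 * Q ^ 5 + 387420489 * p ^ 10) :
    G % 7 = 3 ∨ G % 7 = 5 ∨ G % 7 = 6 := by
  have key : ∀ a b : ZMod 7, 3 ^ 31 * a ^ 17 - 4 * b ^ 17 = 0 → b ≠ 0 →
      2 * b ^ 10 + 39366 * a ^ 5 * b ^ 5 + 387420489 * a ^ 10 = 3 ∨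
      2 * b ^ 10 + 39366 * a ^ 5 * b ^ 5 + 387420489 * a ^ 10 = 5 ∨
      2 * b ^ 10 + 39366 * a ^ 5 * b ^ 5 + 387420489 * a ^ 10 = 6 := by decide +kernel
  have h2 : (Q : ZMod 7) ≠ 0 := by
    intro h; apply h7
    have := (ZMod.intCast_zmod_eq_zero_iff_dvd Q 7).1 h
    omega
  rw [hG]
  rcases key _ _ (z7zero hf) h2 with h | h | h
  · left; exact zres7 (r := 3) (by norm_num) (by push_cast; exact h)
  · right; left; exact zres7 (r := 5) (by norm_num) (by push_cast; exact h)
  · right; right; exact zres7 (r := 6) (by norm_num) (by push_cast; exact h)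

/-- Evaluation of the residue symbols in the generic situation. -/
lemma finA {Q G T T2 U V S : ℤ} {k : ℕ}
    (hQ24 : Q % 24 = 5 ∨ Q % 24 = 11 ∨ Q % 24 = 17 ∨ Q % 24 = 23)
    (ht : T2 % 24 = 1 ∨ T2 % 24 = 5 ∨ T2 % 24 = 7 ∨ T2 % 24 = 11 ∨ T2 % 24 = 13 ∨ T2 % 24 = 17 ∨
        T2 % 24 = 19 ∨ T2 % 24 = 23)
    (hk1 : T % 24 = 14 → k = 1 ∧ T2 % 12 = 7)
    (hk2 : T % 24 = 20 → k = 2) (hk3 : T % 24 = 2 → k = 1 ∧ T2 % 12 = 1)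
    (RT : (Q % 24 = 5 → T % 24 = 8) ∧ (Q % 24 = 11 → T % 24 = 14) ∧
      (Q % 24 = 17 → T % 24 = 20) ∧ (Q % 24 = 23 → T % 24 = 2))
    (RG : (Q % 24 = 5 → Res G 17) ∧
      (Q % 24 = 11 → Res G 5) ∧
      (Q % 24 = 17 → Res G 17) ∧
      (Q % 24 = 23 → Res G 5))
    (RU : (Q % 24 = 5 → U % 24 = 13) ∧
      (Q % 24 = 11 → U % 24 = 7) ∧
      (Q % 24 = 17 → U % 24 = 1) ∧
      (Q % 24 = 23 → U % 24 = 19))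
    (RV : (Q % 24 = 5 → V % 24 = 19) ∧
      (Q % 24 = 11 → V % 24 = 7) ∧
      (Q % 24 = 17 → V % 24 = 19) ∧
      (Q % 24 = 23 → V % 24 = 7))
    (main : ∀ g t u v rQ, Res G g → Res T2 t → Res U u → Res V v → Res Q rQ →
      (k2 g * k2 u * k2 v) ^ k * ee t g * (ee u t * k3 u) *
      (ee (24 - v) t * k2 v * k3 v) * S =
      km g * (ee rQ g * (1)) * k3 g * (ee 7 g * (-1))) : S = 1 := by
  have n6 : T2 % 24 % 2 = 1 ∧ T2 % 24 % 3 ≠ 0 := by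
    clear main hk1 hk2 hk3 RT RG RU RV hQ24; omega
  obtain ⟨t, htt⟩ : ∃ t, T2 % 24 = t := ⟨_, rfl⟩
  have h12 : T2 % 12 = t % 12 := by
    clear main hk1 hk2 hk3 RT RG RU RV hQ24 ht n6; omega
  rw [htt] at ht n6
  rw [h12] at hk1 hk3
  rcases hQ24 with h | h | h | h
  · have e1 := main 17 t 13 19 5 (RG.1 h) ⟨htt, n6⟩
      ⟨RU.1 h, by norm_num, by norm_num⟩ ⟨RV.1 h, by norm_num, by norm_num⟩ ⟨h, by norm_num, by norm_num⟩
    have e2 : k2 17 * k2 13 * k2 19 = 1 := by decide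
    rw [e2, one_pow] at e1
    clear main hk1 hk2 hk3 RT RG RU RV
    rcases ht with rfl | rfl | rfl | rfl | rfl | rfl | rfl | rfl <;>
      (norm_num [k2, k3, km, ee] at e1; linarith)
  · have e1 := main 5 t 7 7 11 (RG.2.1 h) ⟨htt, n6⟩
      ⟨RU.2.1 h, by norm_num, by norm_num⟩ ⟨RV.2.1 h, by norm_num, by norm_num⟩ ⟨h, by norm_num, by norm_num⟩
    obtain ⟨rfl, h13⟩ := hk1 (RT.2.1 h)
    clear main hk1 hk2 hk3 RT RG RU RV
    rcases ht with rfl | rfl | rfl | rfl | rfl | rfl | rfl | rfl <;>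
      first | (norm_num at h13; done) | (norm_num [k2, k3, km, ee] at e1; linarith)
  · have e1 := main 17 t 1 19 17 (RG.2.2.1 h) ⟨htt, n6⟩
      ⟨RU.2.2.1 h, by norm_num, by norm_num⟩ ⟨RV.2.2.1 h, by norm_num, by norm_num⟩ ⟨h, by norm_num, by norm_num⟩
    obtain rfl := hk2 (RT.2.2.1 h)
    clear main hk1 hk2 hk3 RT RG RU RV
    rcases ht with rfl | rfl | rfl | rfl | rfl | rfl | rfl | rfl <;>
      (norm_num [k2, k3, km, ee] at e1; linarith)
  · have e1 := main 5 t 19 7 23 (RG.2.2.2 h) ⟨htt, n6⟩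
      ⟨RU.2.2.2 h, by norm_num, by norm_num⟩ ⟨RV.2.2.2 h, by norm_num, by norm_num⟩ ⟨h, by norm_num, by norm_num⟩
    obtain ⟨rfl, h13⟩ := hk3 (RT.2.2.2 h)
    clear main hk1 hk2 hk3 RT RG RU RV
    rcases ht with rfl | rfl | rfl | rfl | rfl | rfl | rfl | rfl <;>
      first | (norm_num at h13; done) | (norm_num [k2, k3, km, ee] at e1; linarith)

/-- Evaluation of the residue symbols when five divides the linear form. -/
lemma finA5 {Q G T T2 U V S : ℤ} {k : ℕ}
    (hQ24 : Q % 24 = 5 ∨ Q % 24 = 11 ∨ Q % 24 = 17 ∨ Q % 24 = 23)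
    (ht : T2 % 24 = 1 ∨ T2 % 24 = 5 ∨ T2 % 24 = 7 ∨ T2 % 24 = 11 ∨ T2 % 24 = 13 ∨ T2 % 24 = 17 ∨
        T2 % 24 = 19 ∨ T2 % 24 = 23)
    (hk1 : T % 24 = 14 → k = 1 ∧ T2 % 12 = 7)
    (hk2 : T % 24 = 20 → k = 2) (hk3 : T % 24 = 2 → k = 1 ∧ T2 % 12 = 1)
    (RT : (Q % 24 = 5 → T % 24 = 8) ∧ (Q % 24 = 11 → T % 24 = 14) ∧
      (Q % 24 = 17 → T % 24 = 20) ∧ (Q % 24 = 23 → T % 24 = 2))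
    (RG : (Q % 24 = 5 → Res G 13) ∧
      (Q % 24 = 11 → Res G 1) ∧
      (Q % 24 = 17 → Res G 13) ∧
      (Q % 24 = 23 → Res G 1))
    (RU : (Q % 24 = 5 → U % 24 = 13) ∧
      (Q % 24 = 11 → U % 24 = 7) ∧
      (Q % 24 = 17 → U % 24 = 1) ∧
      (Q % 24 = 23 → U % 24 = 19))
    (RV : (Q % 24 = 5 → V % 24 = 23) ∧
      (Q % 24 = 11 → V % 24 = 11) ∧
      (Q % 24 = 17 → V % 24 = 23) ∧
      (Q % 24 = 23 → V % 24 = 11))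
    (main : ∀ g t u v rQ, Res G g → Res T2 t → Res U u → Res V v → Res Q rQ →
      (k2 g * k2 u * k2 v) ^ k * ee t g * (ee u t * k3 u) *
      (ee (24 - v) t * k2 v * k3 v) * S =
      km g * (ee rQ g * (-1)) * k3 g * (ee 7 g * (1))) : S = -1 := by
  have n6 : T2 % 24 % 2 = 1 ∧ T2 % 24 % 3 ≠ 0 := by
    clear main hk1 hk2 hk3 RT RG RU RV hQ24; omega
  obtain ⟨t, htt⟩ : ∃ t, T2 % 24 = t := ⟨_, rfl⟩
  have h12 : T2 % 12 = t % 12 := by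
    clear main hk1 hk2 hk3 RT RG RU RV hQ24 ht n6; omega
  rw [htt] at ht n6
  rw [h12] at hk1 hk3
  rcases hQ24 with h | h | h | h
  · have e1 := main 13 t 13 23 5 (RG.1 h) ⟨htt, n6⟩
      ⟨RU.1 h, by norm_num, by norm_num⟩ ⟨RV.1 h, by norm_num, by norm_num⟩ ⟨h, by norm_num, by norm_num⟩
    have e2 : k2 13 * k2 13 * k2 23 = 1 := by decide
    rw [e2, one_pow] at e1
    clear main hk1 hk2 hk3 RT RG RU RV
    rcases ht with rfl | rfl | rfl | rfl | rfl | rfl | rfl | rfl <;>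
      (norm_num [k2, k3, km, ee] at e1; linarith)
  · have e1 := main 1 t 7 11 11 (RG.2.1 h) ⟨htt, n6⟩
      ⟨RU.2.1 h, by norm_num, by norm_num⟩ ⟨RV.2.1 h, by norm_num, by norm_num⟩ ⟨h, by norm_num, by norm_num⟩
    obtain ⟨rfl, h13⟩ := hk1 (RT.2.1 h)
    clear main hk1 hk2 hk3 RT RG RU RV
    rcases ht with rfl | rfl | rfl | rfl | rfl | rfl | rfl | rfl <;>
      first | (norm_num at h13; done) | (norm_num [k2, k3, km, ee] at e1; linarith)
  · have e1 := main 13 t 1 23 17 (RG.2.2.1 h) ⟨htt, n6⟩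
      ⟨RU.2.2.1 h, by norm_num, by norm_num⟩ ⟨RV.2.2.1 h, by norm_num, by norm_num⟩ ⟨h, by norm_num, by norm_num⟩
    obtain rfl := hk2 (RT.2.2.1 h)
    clear main hk1 hk2 hk3 RT RG RU RV
    rcases ht with rfl | rfl | rfl | rfl | rfl | rfl | rfl | rfl <;>
      (norm_num [k2, k3, km, ee] at e1; linarith)
  · have e1 := main 1 t 19 11 23 (RG.2.2.2 h) ⟨htt, n6⟩
      ⟨RU.2.2.2 h, by norm_num, by norm_num⟩ ⟨RV.2.2.2 h, by norm_num, by norm_num⟩ ⟨h, by norm_num, by norm_num⟩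
    obtain ⟨rfl, h13⟩ := hk3 (RT.2.2.2 h)
    clear main hk1 hk2 hk3 RT RG RU RV
    rcases ht with rfl | rfl | rfl | rfl | rfl | rfl | rfl | rfl <;>
      first | (norm_num at h13; done) | (norm_num [k2, k3, km, ee] at e1; linarith)

/-- Outcome of the second chain when five does not divide `18 p - Q`. -/
lemma caseA {x p Q z : ℤ} (hp : p = x ^ 2)
    (hp24 : p % 24 = 1 ∨ p % 24 = 9 ∨ p % 24 = 17)
    (hQ24 : Q % 24 = 5 ∨ Q % 24 = 11 ∨ Q % 24 = 17 ∨ Q % 24 = 23)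
    (cpQ : IsCoprime p Q) (hf : 3 ^ 31 * p ^ 17 - 4 * Q ^ 17 = 7 * z ^ 2)
    (hpos : 0 < p) (gU : 0 < 18 * p - Q)
    (h7 : Q % 7 ≠ 0) (h5 : (18 * p - Q) % 5 ≠ 0) : KJ 5 (2 * Q + 9 * p) = 1 := by
  obtain ⟨G, hG⟩ : ∃ s, s = 2 * Q ^ 10 + 39366 * p ^ 5 * Q ^ 5 + 387420489 * p ^ 10 := ⟨_, rfl⟩
  obtain ⟨T, hT⟩ : ∃ s, s = Q ^ 3 + 243 * p ^ 3 := ⟨_, rfl⟩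
  obtain ⟨U, hU⟩ : ∃ s, s = 18 * p - Q := ⟨_, rfl⟩
  obtain ⟨V, hV⟩ : ∃ s, s = 2 * Q + 9 * p := ⟨_, rfl⟩
  have hV5 : V % 5 ≠ 0 := by clear hf hG hT hQ24 hp24; omega
  have hU5 : U % 5 ≠ 0 := by clear hf hG hT hQ24 hp24; omega
  have p8 : p % 8 = 1 := by clear hf hG hT hQ24; omega
  have RU : (Q % 24 = 5 → U % 24 = 13) ∧ (Q % 24 = 11 → U % 24 = 7) ∧
      (Q % 24 = 17 → U % 24 = 1) ∧ (Q % 24 = 23 → U % 24 = 19) := by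
    clear hf hG hT hQ24 hp24 h5 h7 hpos gU
    refine ⟨fun h => ?_, fun h => ?_, fun h => ?_, fun h => ?_⟩ <;> omega
  have RV : (Q % 24 = 5 → V % 24 = 19) ∧ (Q % 24 = 11 → V % 24 = 7) ∧
      (Q % 24 = 17 → V % 24 = 19) ∧ (Q % 24 = 23 → V % 24 = 7) := by
    clear hf hG hT hQ24 hp24 h5 h7 hpos gU
    refine ⟨fun h => ?_, fun h => ?_, fun h => ?_, fun h => ?_⟩ <;> omega
  have Q2 : Q % 2 = 1 := by clear hf hG hT RU RV hp24 hU hV; omega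
  have Q3 : Q % 3 ≠ 0 := by clear hf hG hT RU RV hp24 hU hV; omega
  have p2 : p % 2 = 1 := by clear hf hG hT RU RV hp24 hQ24 hU hV; omega
  have p4 : IsCoprime p 4 := by
    have h : IsCoprime 2 p := cop2 p2
    have := (h.pow_left (m := 2)).symm
    norm_num at this; exact this
  have Q6 : IsCoprime Q (6 ^ 20) := by
    have h : IsCoprime 2 Q := cop2 Q2
    have h' : IsCoprime 3 Q := cop3 Q3
    have := (h.mul_left h').symm.pow_right (n := 20)
    norm_num at this ⊢; exact this
  have kp : KJ p Q = 1 := KJ_p hp cpQ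
  have k3Q : KJ 3 Q ^ 2 = 1 := KJ_sq (cop3 Q3)
  have cpG : IsCoprime p G := cop_of_eq (q := 39366 * p ^ 4 * Q ^ 5 + 387420489 * p ^ 9)
    (c := 2 * Q ^ 10) (by rw [hG]; ring) (cpc 4 10 p4 (by norm_num) cpQ)
  have cpU : IsCoprime p U := cop_of_eq (q := 18)
    (c := (-1) * Q ^ 1) (by rw [hU]; ring) (cpc 4 1 p4 (by norm_num) cpQ)
  have cpV : IsCoprime p V := cop_of_eq (q := 9)
    (c := 2 * Q ^ 1) (by rw [hV]; ring) (cpc 4 1 p4 (by norm_num) cpQ)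
  have iQG : G = (2 * Q ^ 9 + 39366 * p ^ 5 * Q ^ 4) * Q + 387420489 * p ^ 10 := by rw [hG]; ring
  have cQG : IsCoprime Q G := cop_of_eq iQG (cpc (6 ^ 20) 10 Q6 (by norm_num) cpQ.symm)
  have cQT : IsCoprime Q T := cop_of_eq (q := Q ^ 2) (c := 243 * p ^ 3) (by rw [hT]; ring)
    (cpc (6 ^ 20) 3 Q6 (by norm_num) cpQ.symm)
  have mG : KJ G Q = 1 := by
    have e : (387420489 : ℤ) = 3 ^ 18 := by norm_num
    have e' : KJ 3 Q ^ 18 = (KJ 3 Q ^ 2) ^ 9 := by ring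
    rw [KJ_mod iQG, KJ_mul, KJ_pow, kp, e, KJ_pow, e', k3Q]; ring
  have hG7 := G7 hf h7 hG
  have m7 : KJ G 7 = -1 := by
    clear hG hf hT RU RV hp24 hQ24 cpG iQG
    rw [KJ_at_seven]; split_ifs <;> first | rfl | omega
  have c7 : IsCoprime 7 G := cop7 (by clear hG hf hT RU RV hp24 hQ24 cpG iQG; omega)
  have gG : 0 < G := by rw [hG]; exact Gpos hpos
  have gU' : 0 < U := by rw [hU]; exact gU
  have i0 : (3 ^ 5 * p ^ 3 * 7) * z ^ 2 =
      (2 * Q ^ 10 - 39366 * p ^ 5 * Q ^ 5 + 387420489 * p ^ 10) * G + (-1 * 2 ^ 2 * Q ^ 17) * T := by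
    rw [mul_assoc, ← hf, hG, hT]; ring
  have i1 : 1 * G = (27 * p * Q ^ 6 + 162 * p ^ 2 * Q ^ 5 - 6561 * p ^ 4 * Q ^ 3 + 1594323 * p ^ 7) * T
      + Q ^ 8 * (U * (-V)) := by
    rw [hG, hT, hU, hV]; ring
  have i2 : 1 * T = (-(Q ^ 2 + 18 * p * Q + 324 * p ^ 2)) * U + (5 ^ 2 * 3 ^ 5) * p ^ 3 := by
    rw [hT, hU]; ring
  have i3 : (2 ^ 3 * 1) * T = (4 * Q ^ 2 - 18 * p * Q + 81 * p ^ 2) * V + (5 * 3 ^ 5) * p ^ 3 := by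
    rw [hT, hV]; ring
  have gT : 0 < -V ∨ 0 < T := by
    rcases lt_or_ge V 0 with h | h
    · left; linarith
    · right; rw [hT]; exact TVsign hpos (by rw [← hV]; exact h)
  have RT := Tres (Q := Q) hp24
  rw [← hT] at RT
  have RG := rG (Q := Q) hp24
  rw [← hG] at RG
  have hT8 : T % 24 = 8 ∨ T % 24 = 14 ∨ T % 24 = 20 ∨ T % 24 = 2 := by
    rcases hQ24 with h | h | h | h
    · exact Or.inl (RT.1 h)
    · exact Or.inr (Or.inl (RT.2.1 h))
    · exact Or.inr (Or.inr (Or.inl (RT.2.2.1 h)))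
    · exact Or.inr (Or.inr (Or.inr (RT.2.2.2 h)))
  obtain ⟨k, T2, hk, ht, hk1, hk2, hk3⟩ := Tsplit hT8
  have gV : 0 < -V ∨ 0 < T2 := by
    rcases gT with h | h
    · exact Or.inl h
    · right; rw [hk] at h; exact (mul_pos_iff_of_pos_left (by positivity)).1 h
  have h1V : KJ 1 V = 1 := jacobiSym.one_left _
  rw [← hV]
  refine finA hQ24 ht hk1 hk2 hk3 RT RG RU RV ?_
  intro g t u v rQ a1 a2 a3 a4 a5
  have := chainA hp i0 i1 i2 i3 hk a1 a2 a3 a4 a5 cpG cpU cpV cQG cQT isCoprime_one_left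
      (cop5 hV5) (cop5 hU5) gG gU' gV mG m7 c7
  rw [h1V, one_mul] at this
  exact this

/-- If five divides `18 p - Q` then it also divides `z`, and a Hensel type argument pins down the
ratio of `p` and `Q` modulo twenty-five. -/
lemma five_prep {p Q z : ℤ} (cpQ : IsCoprime p Q)
    (hf : 3 ^ 31 * p ^ 17 - 4 * Q ^ 17 = 7 * z ^ 2) (h5 : (18 * p - Q) % 5 = 0) :
    Q % 5 ≠ 0 ∧ (∃ w, z = 5 * w) ∧ ∃ m, p = 7 * Q + 25 * m := by
  have hQ5 : Q % 5 ≠ 0 := by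
    intro h
    have h1 : (5 : ℤ) ∣ Q := Int.dvd_of_emod_eq_zero h
    have h2 : (5 : ℤ) ∣ p := by clear hf; omega
    have h3 := cpQ.isUnit_of_dvd' h2 h1
    rw [Int.isUnit_iff] at h3
    omega
  have hz : ∃ w, z = 5 * w := by
    obtain ⟨n, hn⟩ : ∃ n, p = 2 * Q + 5 * n := ⟨(p - 2 * Q) / 5, by clear hf; omega⟩
    have key : ∀ b : ZMod 5, 3 ^ 31 * (2 * b) ^ 17 - 4 * b ^ 17 = 0 := by decide +kernel
    have hp5 : (p : ZMod 5) = 2 * (Q : ZMod 5) := by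
      rw [hn]; push_cast
      have : (5 : ZMod 5) = 0 := by decide
      rw [this]; ring
    have h1 : ((3 ^ 31 * p ^ 17 - 4 * Q ^ 17 : ℤ) : ZMod 5) = 0 := by
      have e : (3 : ZMod 5) ^ 31 = 617673396283947 := by decide +kernel
      have := key (Q : ZMod 5)
      rw [← hp5, e] at this
      push_cast; exact this
    have h2 : (5 : ℤ) ∣ 7 * z ^ 2 := by
      rw [← hf]; exact (ZMod.intCast_zmod_eq_zero_iff_dvd _ 5).1 h1
    have hp : Prime (5 : ℤ) := by norm_num [Int.prime_iff_natAbs_prime]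
    rcases hp.dvd_or_dvd h2 with h | h
    · norm_num at h
    · obtain ⟨w, hw⟩ := hp.dvd_of_dvd_pow h
      exact ⟨w, hw⟩
  refine ⟨hQ5, hz, ?_⟩
  obtain ⟨w, rfl⟩ := hz
  have key : ∀ a b : ZMod 25, 3 ^ 31 * a ^ 17 - 4 * b ^ 17 = 0 → 5 * (18 * a - b) = 0 →
      5 * b ≠ 0 → a - 7 * b = 0 := by decide +kernel
  have h1 : (3 : ZMod 25) ^ 31 * (p : ZMod 25) ^ 17 - 4 * (Q : ZMod 25) ^ 17 = 0 := by
    have h0 : ((3 ^ 31 * p ^ 17 - 4 * Q ^ 17 : ℤ) : ZMod 25) = 0 :=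
      (ZMod.intCast_zmod_eq_zero_iff_dvd _ 25).2 ⟨7 * w ^ 2, by rw [hf]; push_cast; ring⟩
    have e : (3 : ZMod 25) ^ 31 = 617673396283947 := by decide +kernel
    rw [e]; push_cast at h0; exact h0
  have h2 : (5 : ZMod 25) * (18 * (p : ZMod 25) - (Q : ZMod 25)) = 0 := by
    have h0 : ((5 * (18 * p - Q) : ℤ) : ZMod 25) = 0 :=
      (ZMod.intCast_zmod_eq_zero_iff_dvd _ 25).2 (by clear hf; push_cast; omega)
    push_cast at h0; exact h0
  have h3 : (5 : ZMod 25) * (Q : ZMod 25) ≠ 0 := by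
    intro h
    have h0 : ((5 * Q : ℤ) : ZMod 25) = 0 := by push_cast; exact h
    have := (ZMod.intCast_zmod_eq_zero_iff_dvd _ 25).1 h0
    clear hf; push_cast at this; omega
  have h4 := key _ _ h1 h2 h3
  have h0 : ((p - 7 * Q : ℤ) : ZMod 25) = 0 := by push_cast; exact h4
  obtain ⟨m, hm⟩ := (ZMod.intCast_zmod_eq_zero_iff_dvd _ 25).1 h0
  exact ⟨m, by push_cast at hm; linarith⟩

lemma ures {p Q U r s : ℤ} (p8 : p % 8 = 1) (hU : 25 * U = 18 * p - Q) (hQ : Q % 24 = r)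
    (hs : s % 24 = s) (h : (18 - r - s) % 24 = 0) : U % 24 = s := by omega

lemma vres {p Q V r s : ℤ} (p8 : p % 8 = 1) (hV : 5 * V = 2 * Q + 9 * p) (hQ : Q % 24 = r)
    (hs : s % 24 = s) (h : (2 * r + 9 - 5 * s) % 24 = 0) : V % 24 = s := by omega

set_option maxHeartbeats 2000000 in
/-- The second chain, divided by powers of five, is contradictory on its own. -/
lemma caseA5 {x p Q z : ℤ} (hp : p = x ^ 2)
    (hp24 : p % 24 = 1 ∨ p % 24 = 9 ∨ p % 24 = 17)
    (hQ24 : Q % 24 = 5 ∨ Q % 24 = 11 ∨ Q % 24 = 17 ∨ Q % 24 = 23)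
    (cpQ : IsCoprime p Q) (hf : 3 ^ 31 * p ^ 17 - 4 * Q ^ 17 = 7 * z ^ 2)
    (hpos : 0 < p) (gU : 0 < 18 * p - Q)
    (h7 : Q % 7 ≠ 0) (h5 : (18 * p - Q) % 5 = 0) : False := by
  obtain ⟨Q5, ⟨w, hw⟩, m, hm⟩ := five_prep cpQ hf h5
  clear h5
  have x5 : p % 5 = 0 ∨ p % 5 = 1 ∨ p % 5 = 4 := by
    have : x % 5 = 0 ∨ x % 5 = 1 ∨ x % 5 = 2 ∨ x % 5 = 3 ∨ x % 5 = 4 := by omega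
    rcases this with h | h | h | h | h <;> rw [hp, pow_two, Int.mul_emod, h] <;> norm_num
  have Q23 : Q % 5 = 2 ∨ Q % 5 = 3 := by clear hf hp24 hQ24; omega
  obtain ⟨n, hn⟩ : ∃ n, n = 2401 * Q ^ 4 * m + 17150 * Q ^ 3 * m ^ 2 + 61250 * Q ^ 2 * m ^ 3
    + 109375 * Q * m ^ 4 + 78125 * m ^ 5 := ⟨_, rfl⟩
  have hp5 : p ^ 5 = 16807 * Q ^ 5 + 125 * n := by rw [hm, hn]; ring
  obtain ⟨G, hG⟩ : ∃ s, s = 875493598076809 * Q ^ 10 + 39366 * n * Q ^ 5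
    + 387420489 * (33614 * Q ^ 5 * n + 125 * n ^ 2) := ⟨_, rfl⟩
  obtain ⟨T, hT⟩ : ∃ s, s = (3334) * Q ^ 3 * m ^ 0 + (35721) * Q ^ 2 * m ^ 1 + (127575) * Q ^ 1 * m ^ 2 + (151875) * Q ^ 0 * m ^ 3 := ⟨_, rfl⟩
  obtain ⟨U, hU⟩ : ∃ s, s = 5 * Q + 18 * m := ⟨_, rfl⟩
  obtain ⟨V, hV⟩ : ∃ s, s = 13 * Q + 45 * m := ⟨_, rfl⟩
  obtain ⟨r, hr⟩ : ∃ s, s = (262595560311) * Q ^ 7 * m ^ 0 + (6564922734960) * Q ^ 6 * m ^ 1 + (70338698888625) * Q ^ 5 * m ^ 2 + (418683592490625) * Q ^ 4 * m ^ 3 + (1495300082343750) * Q ^ 3 * m ^ 4 + (3204215560546875) * Q ^ 2 * m ^ 5 + (3814542333984375) * Q ^ 1 * m ^ 6 + (1946195068359375) * Q ^ 0 * m ^ 7 := ⟨_, rfl⟩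
  have hG' : 125 * G = 2 * Q ^ 10 + 39366 * p ^ 5 * Q ^ 5 + 387420489 * p ^ 10 := by
    have : p ^ 10 = (p ^ 5) ^ 2 := by ring
    rw [this, hp5, hG]; ring
  have hT' : 25 * T = Q ^ 3 + 243 * p ^ 3 := by rw [hT, hm]; ring
  have hU' : 25 * U = 18 * p - Q := by rw [hU, hm]; ring
  have hV' : 5 * V = 2 * Q + 9 * p := by rw [hV, hm]; ring
  have hr' : 5 * r = 27 * p * Q ^ 6 + 162 * p ^ 2 * Q ^ 5 - 6561 * p ^ 4 * Q ^ 3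
      + 1594323 * p ^ 7 := by rw [hr, hm]; ring
  have Q2 : Q % 2 = 1 := by
    clear hf hG hT hr hn hG' hT' hr' hp5 hp24 Q23 x5; omega
  have Q3 : Q % 3 ≠ 0 := by
    clear hf hG hT hr hn hG' hT' hr' hp5 hp24 Q23 x5; omega
  have p2 : p % 2 = 1 := by
    clear hf hG hT hr hn hG' hT' hr' hp5 hQ24 Q23 x5; omega
  have p8 : p % 8 = 1 := by
    clear hf hG hT hr hn hG' hT' hr' hp5 hQ24 Q23 x5; omega
  have V5 : KJ 5 V = 1 := by
    have V2 : V % 2 = 1 := by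
      clear hf hG hT hr hn hG' hT' hr' hp5 hp24 hQ24 Q23 x5 hm hU hU' hV h7; omega
    have hv5 : V % 5 = 1 ∨ V % 5 = 4 := by clear hf hG hT hr hn hG' hT' hr' hp5 hp24 hQ24 x5 hm hU hU' hV' h7; omega
    clear hf hG hT hr hn hG' hT' hr' hp5 hp24 hQ24 x5 hm hU hU' hV' h7 Q23
    rw [KJ_five V2 (by omega), if_pos hv5]
  have cV5 : IsCoprime 5 V := cop5 (by clear hf hG hT hr hn hG' hT' hr' hp5 hp24 hQ24 x5 hm hU hU' hV' h7; omega)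
  have k5Q : KJ 5 Q = -1 := by
    clear hf hG hT hr hn hG' hT' hr' hp5 hp24 hQ24 x5 hm hU hU' hV hV' h7 V5
    rw [KJ_five Q2 Q5]; split_ifs <;> first | rfl | omega
  have RU : (Q % 24 = 5 → U % 24 = 13) ∧ (Q % 24 = 11 → U % 24 = 7) ∧
      (Q % 24 = 17 → U % 24 = 1) ∧ (Q % 24 = 23 → U % 24 = 19) := 
    ⟨fun h => ures p8 hU' h (by norm_num) (by norm_num), fun h => ures p8 hU' h (by norm_num) (by norm_num),
     fun h => ures p8 hU' h (by norm_num) (by norm_num), fun h => ures p8 hU' h (by norm_num) (by norm_num)⟩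
  have RV : (Q % 24 = 5 → V % 24 = 23) ∧ (Q % 24 = 11 → V % 24 = 11) ∧
      (Q % 24 = 17 → V % 24 = 23) ∧ (Q % 24 = 23 → V % 24 = 11) := 
    ⟨fun h => vres p8 hV' h (by norm_num) (by norm_num), fun h => vres p8 hV' h (by norm_num) (by norm_num),
     fun h => vres p8 hV' h (by norm_num) (by norm_num), fun h => vres p8 hV' h (by norm_num) (by norm_num)⟩
  have p4 : IsCoprime p 4 := by
    have := ((cop2 p2).pow_left (m := 2)).symm
    norm_num at this; exact this
  have Q6 : IsCoprime Q (6 ^ 20) := by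
    have := ((cop2 Q2).mul_left (cop3 Q3)).symm.pow_right (n := 20)
    norm_num at this ⊢; exact this
  have kp : KJ p Q = 1 := KJ_p hp cpQ
  have k3Q : KJ 3 Q ^ 2 = 1 := KJ_sq (cop3 Q3)
  have cpG : IsCoprime p G := by
    have : IsCoprime p (125 * G) := cop_of_eq (q := 39366 * p ^ 4 * Q ^ 5 + 387420489 * p ^ 9)
      (c := 2 * Q ^ 10) (by rw [hG']; ring) (cpc 4 10 p4 (by norm_num) cpQ)
    exact this.of_mul_right_right
  have cpU : IsCoprime p U := by
    have : IsCoprime p (25 * U) := cop_of_eq (q := 18)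
      (c := (-1) * Q ^ 1) (by rw [hU']; ring) (cpc 4 1 p4 (by norm_num) cpQ)
    exact this.of_mul_right_right
  have cpV : IsCoprime p V := by
    have : IsCoprime p (5 * V) := cop_of_eq (q := 9)
      (c := 2 * Q ^ 1) (by rw [hV']; ring) (cpc 4 1 p4 (by norm_num) cpQ)
    exact this.of_mul_right_right
  have iQG : 125 * G = (2 * Q ^ 9 + 39366 * p ^ 5 * Q ^ 4) * Q + 387420489 * p ^ 10 := by
    rw [hG']; ring
  have cQG : IsCoprime Q G := by
    have : IsCoprime Q (125 * G) := cop_of_eq iQG (cpc (6 ^ 20) 10 Q6 (by norm_num) cpQ.symm)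
    exact this.of_mul_right_right
  have cQT : IsCoprime Q T := by
    have : IsCoprime Q (25 * T) := cop_of_eq (q := Q ^ 2) (c := 243 * p ^ 3) (by rw [hT']; ring)
      (cpc (6 ^ 20) 3 Q6 (by norm_num) cpQ.symm)
    exact this.of_mul_right_right
  have mG : KJ G Q = -1 := by
    have e : (387420489 : ℤ) = 3 ^ 18 := by norm_num
    have e' : KJ 3 Q ^ 18 = (KJ 3 Q ^ 2) ^ 9 := by ring
    have e5 : (125 : ℤ) = 5 ^ 3 := by norm_num
    have h1 := KJ_mod iQG
    rw [KJ_mul, KJ_mul, e5, KJ_pow, k5Q, KJ_pow p, kp, e, KJ_pow, e', k3Q] at h1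
    linarith
  have hG7 : G % 7 = 4 ∨ G % 7 = 2 ∨ G % 7 = 1 := by
    have := G7 hf h7 hG'
    clear hf hG hT hr hn hG' hT' hr' hp5 hp24 hQ24 Q23 x5 RU RV iQG
    omega
  have m7 : KJ G 7 = 1 := by
    clear hf hG hT hr hn hG' hT' hr' hp5 hp24 hQ24 Q23 x5 RU RV iQG
    rw [KJ_at_seven]; split_ifs <;> first | rfl | omega
  have c7 : IsCoprime 7 G := cop7 (by
    clear hf hG hT hr hn hG' hT' hr' hp5 hp24 hQ24 Q23 x5 RU RV iQG; omega)
  have gG : 0 < G := by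
    have := Gpos (Q := Q) hpos
    rw [← hG'] at this; linarith
  have gU' : 0 < U := by linarith
  have i0 : (3 ^ 5 * p ^ 3 * 7) * w ^ 2 =
      (5 * (2 * Q ^ 10 - 39366 * p ^ 5 * Q ^ 5 + 387420489 * p ^ 10)) * G
        + (-1 * 2 ^ 2 * Q ^ 17) * T := by
    have h1 : 7 * (5 * w) ^ 2 = 3 ^ 31 * p ^ 17 - 4 * Q ^ 17 := by rw [← hw, hf]
    have h2 : (25 : ℤ) ≠ 0 := by norm_num
    apply mul_left_cancel₀ h2
    linear_combination (243 * p ^ 3) * h1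
      - (2 * Q ^ 10 - 39366 * p ^ 5 * Q ^ 5 + 387420489 * p ^ 10) * hG' + 4 * Q ^ 17 * hT'
  have i1 : 1 * G = r * T + Q ^ 8 * (U * (-V)) := by
    have h2 : (125 : ℤ) ≠ 0 := by norm_num
    apply mul_left_cancel₀ h2
    linear_combination hG' - 25 * T * hr' - (27 * p * Q ^ 6 + 162 * p ^ 2 * Q ^ 5
      - 6561 * p ^ 4 * Q ^ 3 + 1594323 * p ^ 7) * hT' + Q ^ 8 * (5 * V) * hU'
      + Q ^ 8 * (18 * p - Q) * hV'
  have i2 : 1 * T = (-(Q ^ 2 + 18 * p * Q + 324 * p ^ 2)) * U + (1 ^ 2 * 3 ^ 5) * p ^ 3 := by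
    have h2 : (25 : ℤ) ≠ 0 := by norm_num
    apply mul_left_cancel₀ h2
    linear_combination hT' + (Q ^ 2 + 18 * p * Q + 324 * p ^ 2) * hU'
  have i3 : (2 ^ 3 * 5) * T = (4 * Q ^ 2 - 18 * p * Q + 81 * p ^ 2) * V + (1 * 3 ^ 5) * p ^ 3 := by
    have h2 : (5 : ℤ) ≠ 0 := by norm_num
    apply mul_left_cancel₀ h2
    linear_combination 8 * hT' - (4 * Q ^ 2 - 18 * p * Q + 81 * p ^ 2) * hV'
  have gT : 0 < -V ∨ 0 < T := by
    rcases lt_or_ge V 0 with h | h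
    · left; linarith
    · right
      have := TVsign (Q := Q) hpos (by rw [← hV']; linarith)
      rw [← hT'] at this; linarith
  have RT := Tres (Q := Q) hp24
  rw [← hT'] at RT
  have hT25 : (25 * T) % 24 = T % 24 := by
    clear hf hG hT hr hn hG' hT' hr' hp5 hp24 hQ24 Q23 x5 RU RV iQG RT i0 i1 i2 i3 gT hG7
    omega
  rw [hT25] at RT
  have RG0 := rG (Q := Q) hp24
  rw [← hG'] at RG0
  have resG : ∀ a b : ℤ, Res (125 * G) a → (5 * a) % 24 = b → b % 2 = 1 → b % 3 ≠ 0 → Res G b := by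
    intro a b h1 h2 h3 h4
    refine ⟨?_, h3, h4⟩
    have := h1.1
    clear hf hG hT hr hn hG' hT' hr' hp5 hp24 hQ24 Q23 x5 RU RV iQG RT i0 i1 i2 i3 gT hG7 RG0 h1
    omega
  have RG : (Q % 24 = 5 → Res G 13) ∧ (Q % 24 = 11 → Res G 1) ∧
      (Q % 24 = 17 → Res G 13) ∧ (Q % 24 = 23 → Res G 1) :=
    ⟨fun h => resG _ _ (RG0.1 h) (by norm_num) (by norm_num) (by norm_num),
     fun h => resG _ _ (RG0.2.1 h) (by norm_num) (by norm_num) (by norm_num),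
     fun h => resG _ _ (RG0.2.2.1 h) (by norm_num) (by norm_num) (by norm_num),
     fun h => resG _ _ (RG0.2.2.2 h) (by norm_num) (by norm_num) (by norm_num)⟩
  have hT8 : T % 24 = 8 ∨ T % 24 = 14 ∨ T % 24 = 20 ∨ T % 24 = 2 := by
    rcases hQ24 with h | h | h | h
    · exact Or.inl (RT.1 h)
    · exact Or.inr (Or.inl (RT.2.1 h))
    · exact Or.inr (Or.inr (Or.inl (RT.2.2.1 h)))
    · exact Or.inr (Or.inr (Or.inr (RT.2.2.2 h)))
  obtain ⟨k, T2, hk, ht, hk1, hk2, hk3⟩ := Tsplit hT8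
  have gV : 0 < -V ∨ 0 < T2 := by
    rcases gT with h | h
    · exact Or.inl h
    · right; rw [hk] at h; exact (mul_pos_iff_of_pos_left (by positivity)).1 h
  have h1V : KJ 1 V = 1 := jacobiSym.one_left _
  have fin : KJ 5 V * KJ 1 V = -1 := by
    refine finA5 hQ24 ht hk1 hk2 hk3 RT RG RU RV ?_
    intro g t u v rQ a1 a2 a3 a4 a5
    exact chainA hp i0 i1 i2 i3 hk a1 a2 a3 a4 a5 cpG cpU cpV cQG cQT cV5
      isCoprime_one_left isCoprime_one_left gG gU' gV mG m7 c7
  rw [V5, h1V] at fin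
  norm_num at fin


lemma KJ_five_one {b : ℤ} (h2 : b % 2 = 1) (h5 : b % 5 ≠ 0) (h : KJ 5 b = 1) :
    b % 5 = 1 ∨ b % 5 = 4 := by
  rw [KJ_five h2 h5] at h
  by_contra hc
  rw [if_neg hc] at h
  norm_num at h

/-- The two chains contradict each other, because two is not a square modulo five. -/
lemma case_one {p Q : ℤ} (p2 : p % 2 = 1) (Q2 : Q % 2 = 1) (h5 : (18 * p - Q) % 5 ≠ 0)
    (hU : KJ 5 (18 * p - Q) = 1) (hV : KJ 5 (2 * Q + 9 * p) = 1) : False := by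
  have h1 := KJ_five_one (by omega) h5 hU
  have h2 := KJ_five_one (by omega) (by omega) hV
  omega

lemma sq_mod8 {x : ℤ} (hx : Odd x) : x ^ 2 % 8 = 1 := by
  have h : x % 8 = 1 ∨ x % 8 = 3 ∨ x % 8 = 5 ∨ x % 8 = 7 := by
    have := Int.odd_iff.1 hx
    omega
  rcases h with h | h | h | h <;> rw [pow_two, Int.mul_emod, h] <;> norm_num

lemma mod_three {p Q z : ℤ} (hf : 3 ^ 31 * p ^ 17 - 4 * Q ^ 17 = 7 * z ^ 2) (hc : Int.gcd Q z = 1) :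
    Q % 3 = 2 := by
  have key : ∀ b c : ZMod 3, -(4 * b ^ 17) = 7 * c ^ 2 → b = 2 ∨ (b = 0 ∧ c = 0) := by
    decide +kernel
  have h1 : -(4 * (Q : ZMod 3) ^ 17) = 7 * (z : ZMod 3) ^ 2 := by
    have h2 := congrArg (Int.cast : ℤ → ZMod 3) hf
    push_cast at h2
    have e : (617673396283947 : ZMod 3) = 0 := by decide +kernel
    rw [e, zero_mul, zero_sub] at h2
    exact h2
  rcases key _ _ h1 with h | ⟨h, h'⟩
  · have h0 : ((Q - 2 : ℤ) : ZMod 3) = 0 := by push_cast; rw [h]; ring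
    have := (ZMod.intCast_zmod_eq_zero_iff_dvd _ 3).1 h0
    clear hf; push_cast at this; omega
  · have a1 := (ZMod.intCast_zmod_eq_zero_iff_dvd _ 3).1 h
    have a2 := (ZMod.intCast_zmod_eq_zero_iff_dvd _ 3).1 h'
    have := (Int.isCoprime_iff_gcd_eq_one.2 hc).isUnit_of_dvd' a1 a2
    rw [Int.isUnit_iff] at this
    norm_num at this

lemma mod_seven {p Q z : ℤ} (hf : 3 ^ 31 * p ^ 17 - 4 * Q ^ 17 = 7 * z ^ 2) (cpQ : IsCoprime p Q) :
    Q % 7 ≠ 0 := by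
  intro h
  have h7 : (7 : ℤ) ∣ Q := Int.dvd_of_emod_eq_zero h
  have h1 : (7 : ℤ) ∣ 3 ^ 31 * p ^ 17 := by
    have e : 3 ^ 31 * p ^ 17 = 7 * z ^ 2 + 4 * Q ^ 17 := by linarith
    rw [e]
    exact dvd_add (dvd_mul_right _ _) ((dvd_pow h7 (by norm_num)).mul_left _)
  have hp : Prime (7 : ℤ) := by norm_num [Int.prime_iff_natAbs_prime]
  rcases hp.dvd_or_dvd h1 with h2 | h2
  · have h3 := hp.dvd_of_dvd_pow h2
    norm_num at h3
  · have := cpQ.isUnit_of_dvd' (hp.dvd_of_dvd_pow h2) h7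
    rw [Int.isUnit_iff] at this
    norm_num at this

/-- Size restriction on `Q` coming from positivity of the right hand side. -/
lemma region {p Q z : ℤ} (hf : 3 ^ 31 * p ^ 17 - 4 * Q ^ 17 = 7 * z ^ 2) (hpos : 0 < p)
    (hQ : Q % 2 = 1) : Q < 0 ∨ (0 < Q ∧ 13 * Q < 10 * (9 * p)) := by
  rcases lt_trichotomy Q 0 with h | h | h
  · exact Or.inl h
  · rw [h] at hQ; norm_num at hQ
  · right
    refine ⟨h, ?_⟩
    by_contra hc
    have h1 : 90 * p ≤ 13 * Q := by linarith
    have h2 : (90 * p) ^ 17 ≤ (13 * Q) ^ 17 := pow_le_pow_left₀ (by linarith) h1 17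
    rw [mul_pow, mul_pow] at h2
    have h3 : 0 < p ^ 17 := by positivity
    have h4 := sq_nonneg z
    norm_num at h2 hf
    linarith

theorem no_solutions_Kraus2_p_17 :
    ¬ ∃ x y z : ℤ, Odd x ∧ Odd y ∧ Odd z ∧
      Int.gcd x y = 1 ∧ Int.gcd x z = 1 ∧ Int.gcd y z = 1 ∧
      3 ^ 31 * x ^ 34 - 4 * y ^ 17 = 7 * z ^ 2 := by
  rintro ⟨x, Q, z, ox, oQ, oz, cxQ, cxz, cQz, hf0⟩
  obtain ⟨p, hp⟩ : ∃ p, p = x ^ 2 := ⟨_, rfl⟩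
  have hf : 3 ^ 31 * p ^ 17 - 4 * Q ^ 17 = 7 * z ^ 2 := by rw [← hf0, hp]; ring
  clear hf0
  have p8 : p % 8 = 1 := by rw [hp]; exact sq_mod8 ox
  have Q2 : Q % 2 = 1 := Int.odd_iff.1 oQ
  have Q3 := mod_three hf cQz
  have cpQ : IsCoprime p Q := by
    rw [hp]; exact (Int.isCoprime_iff_gcd_eq_one.2 cxQ).pow_left
  have hpos : 0 < p := by
    have h0 := sq_nonneg x
    rw [← hp] at h0
    clear hf; omega
  have h7 := mod_seven hf cpQ
  have hreg := region hf hpos Q2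
  have hp24 : p % 24 = 1 ∨ p % 24 = 9 ∨ p % 24 = 17 := by clear hf hreg; omega
  have hQ24 : Q % 24 = 5 ∨ Q % 24 = 11 ∨ Q % 24 = 17 ∨ Q % 24 = 23 := by
    clear hf hreg hp24 h7; omega
  have gU : 0 < 18 * p - Q := by
    rcases hreg with h | ⟨h, h'⟩ <;> linarith
  by_cases h5 : (18 * p - Q) % 5 = 0
  · exact caseA5 hp hp24 hQ24 cpQ hf hpos gU h7 h5
  · exact case_one (by clear hf hreg hp24 hQ24 h7 h5; omega) Q2 h5
      (caseB hp hp24 hQ24 cpQ hf hpos hreg h7 h5)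
      (caseA hp hp24 hQ24 cpQ hf hpos gU h7 h5)
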